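/- arXiv:2303.06104 — 2 statements merged into one kernel-verified Lean document; each statement's English description precedes it below -/
import Mathlib

section
/- Let Φ ∈ ℝ \ ℤ and α > 0. If C' ≥ 0 is such that for every measurable V : ℝ² → ℝ with [V]_α < ∞, every finite-dimensional complex subspace M of C_c^∞(ℝ²\{0}; ℂ) that is V-negative for D_Φ satisfies dim M ≤ C' · [V]_α, then C' ≥ (Γ((1+α)/2) / (4 π^{3/2} Γ(1+α/2))) · ∑_{n∈ℤ} |n−Φ|^{−1−α}. (Explicit lower bound on the optimal constant in the weak-type weighted CLR inequality.) -/
open MeasureTheory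

/-- The square of the Euclidean norm on `ℝ²`. -/
noncomputable def sqnorm (x : ℝ × ℝ) : ℝ := x.1 ^ 2 + x.2 ^ 2

/-- Smooth compactly supported functions on `ℝ²` vanishing in a neighbourhood of `0`. -/
def IsTestFun (u : ℝ × ℝ → ℂ) : Prop :=
  ContDiff ℝ (⊤ : ℕ∞) u ∧ HasCompactSupport u ∧ ∀ᶠ x in nhds (0 : ℝ × ℝ), u x = 0

/-- The magnetic energy `∫ |D_Φ u|²` for the Aharonov–Bohm vector potential
`A(x) = |x|⁻² (x₂, -x₁)`, where `D_Φ u = -i∇u + Φ A u`. -/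
noncomputable def magEnergy (Φ : ℝ) (u : ℝ × ℝ → ℂ) : ℝ :=
  ∫ x : ℝ × ℝ,
    (‖-Complex.I * fderiv ℝ u x (1, 0) + ((Φ * (x.2 / sqnorm x) : ℝ) : ℂ) * u x‖ ^ 2 +
     ‖-Complex.I * fderiv ℝ u x (0, 1) + ((Φ * (-x.1 / sqnorm x) : ℝ) : ℂ) * u x‖ ^ 2)

/-- A subspace `M` of test functions is `V`-negative for `D_Φ` if
every nonzero `u ∈ M` satisfies `∫ |D_Φ u|² < ∫ V |u|²`. -/
def IsVNegative (Φ : ℝ) (V : ℝ × ℝ → ℝ) (M : Submodule ℂ (ℝ × ℝ → ℂ)) : Prop :=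
  (∀ u ∈ M, IsTestFun u) ∧
  ∀ u ∈ M, u ≠ 0 → magEnergy Φ u < ∫ x : ℝ × ℝ, V x * ‖u x‖ ^ 2
open scoped ENNReal

/-- The weak weighted norm `[V]_α = sup_{t>0} t^{1+α/2} ∫_{{|x|² V(x)₊ > t}} |x|⁻² dx`. -/
noncomputable def weakNorm (α : ℝ) (V : ℝ × ℝ → ℝ) : ℝ≥0∞ :=
  ⨆ (t : ℝ) (_ : 0 < t), ENNReal.ofReal (t ^ (1 + α / 2)) *
    ∫⁻ x in {x : ℝ × ℝ | t < sqnorm x * max (V x) 0}, ENNReal.ofReal (sqnorm x)⁻¹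

open scoped ContDiff

/-- The logarithmic polar parametrisation of the punctured plane. -/
noncomputable def logPolar (s θ : ℝ) : ℝ × ℝ := (Real.exp s * Real.cos θ, Real.exp s * Real.sin θ)

/-- The logarithm of the Euclidean norm. -/
noncomputable def logRad (x : ℝ × ℝ) : ℝ := Real.log (sqnorm x) / 2

/-- The angular character `e^{inθ}` as a function on the plane. -/
noncomputable def angChar (n : ℤ) (x : ℝ × ℝ) : ℂ :=
  (((x.1 : ℂ) + x.2 * Complex.I) / (√(sqnorm x) : ℝ)) ^ n

/-- The function on the plane with radial profiles `f k` in the angular momentum channels `ν k`. -/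
noncomputable def waveSum {κ : Type*} [Fintype κ] (ν : κ → ℤ) (f : κ → ℝ → ℂ) (x : ℝ × ℝ) : ℂ :=
  ∑ k, angChar (ν k) x * f k (logRad x)

theorem sqnorm_logPolar (s θ : ℝ) : sqnorm (logPolar s θ) = Real.exp (2 * s) := by
  have h : Real.exp (2 * s) = Real.exp s ^ 2 := by rw [← Real.exp_nat_mul]; simp
  rw [h, sqnorm, logPolar]
  linear_combination (Real.exp s ^ 2) * Real.sin_sq_add_cos_sq θ

theorem logRad_logPolar (s θ : ℝ) : logRad (logPolar s θ) = s := by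
  simp [logRad, sqnorm_logPolar]

theorem angChar_logPolar (n : ℤ) (s θ : ℝ) :
    angChar n (logPolar s θ) = Complex.exp (n * θ * Complex.I) := by
  have h1 : √(sqnorm (logPolar s θ)) = Real.exp s := by
    rw [sqnorm_logPolar, Real.sqrt_eq_iff_mul_self_eq (by positivity) (by positivity),
      ← Real.exp_add, two_mul]
  have h2 : (Real.exp s : ℂ) ≠ 0 := by exact_mod_cast (Real.exp_pos s).ne'
  have h3 : (((logPolar s θ).1 : ℂ) + (logPolar s θ).2 * Complex.I) / (Real.exp s : ℝ)
      = Complex.exp (θ * Complex.I) := by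
    rw [div_eq_iff h2, Complex.exp_mul_I]
    simp only [logPolar]
    push_cast
    ring
  rw [angChar, h1, h3, ← Complex.exp_int_mul, mul_assoc]

theorem waveSum_logPolar {κ : Type*} [Fintype κ] (ν : κ → ℤ) (f : κ → ℝ → ℂ) (s θ : ℝ) :
    waveSum ν f (logPolar s θ) = ∑ k, Complex.exp (ν k * θ * Complex.I) * f k s := by
  simp [waveSum, angChar_logPolar, logRad_logPolar]

theorem continuous_sqnorm : Continuous sqnorm := by
  unfold sqnorm; fun_prop

theorem sqnorm_pos {x : ℝ × ℝ} (hx : x ≠ 0) : 0 < sqnorm x := by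
  unfold sqnorm
  by_contra! h
  apply hx
  have h1 : x.1 = 0 := by nlinarith [sq_nonneg x.1, sq_nonneg x.2]
  have h2 : x.2 = 0 := by nlinarith [sq_nonneg x.1, sq_nonneg x.2]
  exact Prod.ext h1 h2

theorem sqnorm_nonneg (x : ℝ × ℝ) : 0 ≤ sqnorm x := by
  unfold sqnorm; positivity

theorem contDiffAt_angChar (n : ℤ) {x : ℝ × ℝ} (hx : x ≠ 0) :
    ContDiffAt ℝ ∞ (angChar n) x := by
  have hpos := sqnorm_pos hx
  have hs : √(sqnorm x) ≠ 0 := (Real.sqrt_pos.2 hpos).ne'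
  have hsq : ContDiffAt ℝ ∞ sqnorm x := by unfold sqnorm; fun_prop
  have hroot : ContDiffAt ℝ ∞ (fun x => √(sqnorm x)) x := hsq.sqrt hpos.ne'
  have hbase : ContDiffAt ℝ ∞
      (fun x : ℝ × ℝ => ((x.1 : ℂ) + x.2 * Complex.I) / (√(sqnorm x) : ℝ)) x := by
    have h1 : ContDiffAt ℝ ∞ (fun x : ℝ × ℝ => ((x.1 : ℝ) : ℂ)) x :=
      Complex.ofRealCLM.contDiff.contDiffAt.comp x contDiffAt_fst
    have h2 : ContDiffAt ℝ ∞ (fun x : ℝ × ℝ => ((x.2 : ℝ) : ℂ)) x :=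
      Complex.ofRealCLM.contDiff.contDiffAt.comp x contDiffAt_snd
    have h3 : ContDiffAt ℝ ∞ (fun x : ℝ × ℝ => ((√(sqnorm x) : ℝ) : ℂ)) x :=
      Complex.ofRealCLM.contDiff.contDiffAt.comp x hroot
    simp only [div_eq_mul_inv]
    exact (h1.add (h2.mul contDiffAt_const)).mul (h3.inv (by exact_mod_cast hs))
  have hne : ((x.1 : ℂ) + x.2 * Complex.I) / (√(sqnorm x) : ℝ) ≠ 0 := by
    refine div_ne_zero ?_ (by exact_mod_cast hs)
    intro h
    apply hx
    have hre := congrArg Complex.re h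
    have him := congrArg Complex.im h
    simp at hre him
    exact Prod.ext hre him
  have hz : ContDiffAt ℝ ∞ (fun z : ℂ => z ^ n)
      (((x.1 : ℂ) + x.2 * Complex.I) / (√(sqnorm x) : ℝ)) :=
    (((analyticAt_id (𝕜 := ℂ)).zpow (n := n) hne).contDiffAt).restrict_scalars ℝ
  exact hz.comp x hbase

theorem isTestFun_waveSum {κ : Type*} [Fintype κ] (ν : κ → ℤ) (f : κ → ℝ → ℂ)
    (hf : ∀ k, ContDiff ℝ ∞ (f k)) {B : ℝ} (hf0 : ∀ k s, s ≤ 0 → f k s = 0)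
    (hfB : ∀ k s, B ≤ s → f k s = 0) : IsTestFun (waveSum ν f) := by
  have hzero : ∀ x, sqnorm x < 1 → waveSum ν f x = 0 := by
    intro x hx
    refine Finset.sum_eq_zero fun k _ => ?_
    rw [hf0 k, mul_zero]
    have := Real.log_nonpos (sqnorm_nonneg x) hx.le
    rw [logRad]; linarith
  have hnear : ∀ᶠ x in nhds (0 : ℝ × ℝ), waveSum ν f x = 0 := by
    have : ∀ᶠ x in nhds (0 : ℝ × ℝ), sqnorm x < 1 :=
      continuous_sqnorm.continuousAt.eventually_lt continuousAt_const (by simp [sqnorm])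
    exact this.mono hzero
  refine ⟨contDiff_iff_contDiffAt.2 fun x => ?_, ?_, hnear⟩
  · by_cases hx : x = 0
    · subst hx
      exact contDiffAt_const.congr_of_eventuallyEq hnear
    · unfold waveSum
      refine ContDiffAt.sum fun k _ => (contDiffAt_angChar _ hx).mul ?_
      have hsq : ContDiffAt ℝ ∞ sqnorm x := by unfold sqnorm; fun_prop
      have : ContDiffAt ℝ ∞ logRad x := by
        unfold logRad
        exact (hsq.log (sqnorm_pos hx).ne').div_const 2
      exact (hf k).contDiffAt.comp x this
  · refine HasCompactSupport.intro (isCompact_closedBall (0 : ℝ × ℝ) (Real.exp B)) fun x hx => ?_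
    refine Finset.sum_eq_zero fun k _ => ?_
    rw [hfB k, mul_zero]
    have h1 : Real.exp B < ‖x‖ := by simpa using hx
    have h2 : ‖x‖ ^ 2 ≤ sqnorm x := by
      rw [Prod.norm_def, sqnorm]
      rcases max_cases ‖x.1‖ ‖x.2‖ with h | h <;> rw [h.1, Real.norm_eq_abs, sq_abs] <;>
        nlinarith [sq_nonneg x.1, sq_nonneg x.2]
    have h3 : Real.exp (2 * B) ≤ sqnorm x := by
      have : Real.exp (2 * B) = Real.exp B ^ 2 := by rw [← Real.exp_nat_mul]; simp
      rw [this]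
      exact (pow_le_pow_left₀ (by positivity) h1.le 2).trans h2
    have h4 := (Real.le_log_iff_exp_le (lt_of_lt_of_le (by positivity) h3)).2 h3
    rw [logRad]; linarith

theorem image_exp_univ : Real.exp '' Set.univ = Set.Ioi 0 := by
  rw [Set.image_univ, Real.range_exp]

theorem abs_exp_smul_inv_mul_log (g : ℝ → ℂ) (s : ℝ) :
    |Real.exp s| • (((Real.exp s)⁻¹ : ℝ) * g (Real.log (Real.exp s))) = g s := by
  rw [abs_of_pos (Real.exp_pos s), Real.log_exp, Complex.real_smul, ← mul_assoc,
    ← Complex.ofReal_mul,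
    mul_inv_cancel₀ (Real.exp_pos s).ne', Complex.ofReal_one, one_mul]

theorem integrableOn_inv_mul_comp_log {g : ℝ → ℂ} (hg : Integrable g) :
    IntegrableOn (fun r : ℝ => ((r⁻¹ : ℝ) : ℂ) * g (Real.log r)) (Set.Ioi 0) := by
  rw [← image_exp_univ, integrableOn_image_iff_integrableOn_abs_deriv_smul MeasurableSet.univ
    (fun x _ => (Real.hasDerivAt_exp x).hasDerivWithinAt) Real.exp_injective.injOn]
  simpa only [abs_exp_smul_inv_mul_log, integrableOn_univ] using hg

theorem integral_inv_mul_comp_log (g : ℝ → ℂ) :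
    ∫ r in Set.Ioi (0 : ℝ), ((r⁻¹ : ℝ) : ℂ) * g (Real.log r) = ∫ s, g s := by
  rw [← image_exp_univ, integral_image_eq_integral_abs_deriv_smul MeasurableSet.univ
    (fun x _ => (Real.hasDerivAt_exp x).hasDerivWithinAt) Real.exp_injective.injOn]
  simp only [abs_exp_smul_inv_mul_log, setIntegral_univ]

theorem integral_exp_int_mul (n : ℤ) :
    ∫ θ in Set.Ioo (-Real.pi) Real.pi, Complex.exp (n * θ * Complex.I) =
      if n = 0 then 2 * (Real.pi : ℂ) else 0 := by
  rw [← integral_Ioc_eq_integral_Ioo,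
    ← intervalIntegral.integral_of_le (by linarith [Real.pi_pos])]
  split_ifs with h
  · simp [h]; ring
  · have hc : (n : ℂ) * Complex.I ≠ 0 := mul_ne_zero (by exact_mod_cast h) Complex.I_ne_zero
    have := integral_exp_mul_complex (a := -Real.pi) (b := Real.pi) hc
    simp only [mul_right_comm _ Complex.I] at this
    rw [this, div_eq_zero_iff]
    left
    rw [sub_eq_zero]
    refine Complex.exp_eq_exp_iff_exists_int.2 ⟨n, ?_⟩
    push_cast; ring

/-- Parseval in the angular variable: the integral of a function whose expression in logarithmic
polar coordinates is a finite sum of products of two angular modes. -/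
theorem integral_of_logPolar_expansion {κ : Type*} [Fintype κ] {ν : κ → ℤ}
    (hν : Function.Injective ν) (H : ℝ × ℝ → ℝ) (A : κ → κ → ℝ → ℂ)
    (hA : ∀ n k, Integrable (A n k))
    (hH : ∀ s θ, ((Real.exp (2 * s) * H (logPolar s θ) : ℝ) : ℂ) =
      ∑ n, ∑ k, Complex.exp (((ν n - ν k : ℤ) : ℂ) * θ * Complex.I) * A n k s) :
    ((∫ x, H x : ℝ) : ℂ) = 2 * Real.pi * ∑ n, ∫ s, A n n s := by
  have hint : ∀ n k, Integrable (fun p : ℝ × ℝ => (((p.1⁻¹ : ℝ) : ℂ) * A n k (Real.log p.1)) *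
      Complex.exp (((ν n - ν k : ℤ) : ℂ) * p.2 * Complex.I))
      ((volume.restrict (Set.Ioi 0)).prod (volume.restrict (Set.Ioo (-Real.pi) Real.pi))) := by
    intro n k
    refine Integrable.mul_prod (f := fun r : ℝ => ((r⁻¹ : ℝ) : ℂ) * A n k (Real.log r))
      (g := fun θ : ℝ => Complex.exp (((ν n - ν k : ℤ) : ℂ) * θ * Complex.I))
      (integrableOn_inv_mul_comp_log (hA n k)) ?_
    have hc : Continuous fun θ : ℝ => Complex.exp (((ν n - ν k : ℤ) : ℂ) * θ * Complex.I) := by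
      fun_prop
    exact (hc.integrableOn_Icc (a := -Real.pi) (b := Real.pi)).mono_set Set.Ioo_subset_Icc_self
  have hpt : ∀ p ∈ polarCoord.target, p.1 • ((H (polarCoord.symm p) : ℝ) : ℂ) =
      ∑ n, ∑ k, (((p.1⁻¹ : ℝ) : ℂ) * A n k (Real.log p.1)) *
        Complex.exp (((ν n - ν k : ℤ) : ℂ) * p.2 * Complex.I) := by
    intro p hp
    have hp1 : 0 < p.1 := by simpa using hp.1
    have h1 : polarCoord.symm p = logPolar (Real.log p.1) p.2 := by
      simp [logPolar, Real.exp_log hp1]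
    have h2 : Real.exp (2 * Real.log p.1) = p.1 * p.1 := by
      rw [two_mul, Real.exp_add, Real.exp_log hp1]
    have h3 := hH (Real.log p.1) p.2
    rw [← h1, h2] at h3
    have h4 : p.1 • ((H (polarCoord.symm p) : ℝ) : ℂ) =
        ((p.1⁻¹ : ℝ) : ℂ) * ((p.1 * p.1 * H (polarCoord.symm p) : ℝ) : ℂ) := by
      rw [Complex.real_smul, ← Complex.ofReal_mul, ← Complex.ofReal_mul]
      congr 1
      field_simp
    rw [h4, h3, Finset.mul_sum]
    refine Finset.sum_congr rfl fun n _ => ?_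
    rw [Finset.mul_sum]
    refine Finset.sum_congr rfl fun k _ => ?_
    ring
  rw [← integral_complex_ofReal, ← integral_comp_polarCoord_symm,
    setIntegral_congr_fun polarCoord.open_target.measurableSet hpt, polarCoord_target,
    Measure.volume_eq_prod, ← Measure.prod_restrict,
    integral_finsetSum _ fun n _ => integrable_finsetSum _ fun k _ => hint n k, Finset.mul_sum]
  refine Finset.sum_congr rfl fun n _ => ?_
  rw [integral_finsetSum _ fun k _ => hint n k, Finset.sum_eq_single n]
  · rw [integral_prod_mul (fun r : ℝ => ((r⁻¹ : ℝ) : ℂ) * A n n (Real.log r))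
      (fun θ : ℝ => Complex.exp (((ν n - ν n : ℤ) : ℂ) * θ * Complex.I)),
      integral_inv_mul_comp_log, integral_exp_int_mul]
    simp [mul_comm]
  · intro k _ hk
    rw [integral_prod_mul (fun r : ℝ => ((r⁻¹ : ℝ) : ℂ) * A n k (Real.log r))
      (fun θ : ℝ => Complex.exp (((ν n - ν k : ℤ) : ℂ) * θ * Complex.I)), integral_exp_int_mul,
      if_neg (sub_ne_zero.2 fun h => hk (hν h).symm), mul_zero]
  · simp

theorem norm_sq_sum_exp_mul {κ : Type*} [Fintype κ] (ν : κ → ℤ) (a : κ → ℂ) (θ : ℝ) :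
    ((‖∑ k, Complex.exp (ν k * θ * Complex.I) * a k‖ ^ 2 : ℝ) : ℂ) =
      ∑ n, ∑ k, Complex.exp (((ν n - ν k : ℤ) : ℂ) * θ * Complex.I) *
        (a n * (starRingEnd ℂ) (a k)) := by
  rw [Complex.ofReal_pow, ← Complex.mul_conj', map_sum, Finset.sum_mul_sum]
  refine Finset.sum_congr rfl fun n _ => Finset.sum_congr rfl fun k _ => ?_
  have h : (starRingEnd ℂ) (Complex.exp (ν k * θ * Complex.I)) =
      Complex.exp (-(ν k * θ * Complex.I)) := by
    rw [← Complex.exp_conj]; simp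
  have h2 : Complex.exp (((ν n - ν k : ℤ) : ℂ) * θ * Complex.I) =
      Complex.exp (ν n * θ * Complex.I) * Complex.exp (-(ν k * θ * Complex.I)) := by
    rw [← Complex.exp_add]; congr 1; push_cast; ring
  rw [map_mul, h, h2]; ring

theorem integral_potential_waveSum {κ : Type*} [Fintype κ] {ν : κ → ℤ}
    (hν : Function.Injective ν) (f : κ → ℝ → ℂ) (W : ℝ → ℝ)
    (hW : ∀ n k, Integrable fun s => (W s : ℂ) * (f n s * (starRingEnd ℂ) (f k s))) :
    ∫ x, (sqnorm x)⁻¹ * W (logRad x) * ‖waveSum ν f x‖ ^ 2 =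
      2 * Real.pi * ∑ n, ∫ s, W s * ‖f n s‖ ^ 2 := by
  have := integral_of_logPolar_expansion hν
    (fun x => (sqnorm x)⁻¹ * W (logRad x) * ‖waveSum ν f x‖ ^ 2)
    (fun n k s => (W s : ℂ) * (f n s * (starRingEnd ℂ) (f k s))) hW ?_
  · apply Complex.ofReal_injective
    rw [this]
    push_cast
    congr 1
    refine Finset.sum_congr rfl fun n _ => ?_
    rw [← integral_complex_ofReal]
    simp [Complex.mul_conj']
  · intro s θ
    simp only [waveSum_logPolar, sqnorm_logPolar, logRad_logPolar]
    rw [← mul_assoc, ← mul_assoc, mul_inv_cancel₀ (Real.exp_pos _).ne', one_mul,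
      Complex.ofReal_mul, norm_sq_sum_exp_mul, Finset.mul_sum]
    refine Finset.sum_congr rfl fun n _ => ?_
    rw [Finset.mul_sum]
    exact Finset.sum_congr rfl fun k _ => by ring

theorem hasDerivAt_logPolar_left (s θ : ℝ) :
    HasDerivAt (fun s => logPolar s θ) (logPolar s θ) s :=
  ((Real.hasDerivAt_exp s).mul_const _).prodMk ((Real.hasDerivAt_exp s).mul_const _)

theorem hasDerivAt_logPolar_right (s θ : ℝ) :
    HasDerivAt (fun θ => logPolar s θ) (-(logPolar s θ).2, (logPolar s θ).1) θ := by
  have h := ((Real.hasDerivAt_cos θ).const_mul (Real.exp s)).prodMk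
    ((Real.hasDerivAt_sin θ).const_mul (Real.exp s))
  simpa [logPolar] using h

theorem sqnorm_mul_magnetic_density (Φ : ℝ) {x : ℝ × ℝ} (hx : sqnorm x ≠ 0)
    (L : ℝ × ℝ →L[ℝ] ℂ) (z : ℂ) :
    sqnorm x * (‖-Complex.I * L (1, 0) + ((Φ * (x.2 / sqnorm x) : ℝ) : ℂ) * z‖ ^ 2 +
      ‖-Complex.I * L (0, 1) + ((Φ * (-x.1 / sqnorm x) : ℝ) : ℂ) * z‖ ^ 2) =
    ‖L x‖ ^ 2 + ‖-Complex.I * L (-x.2, x.1) - Φ * z‖ ^ 2 := by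
  have h1 : L x = x.1 * L (1, 0) + x.2 * L (0, 1) := by
    conv_lhs => rw [show x = x.1 • (1, 0) + x.2 • (0, 1) by ext <;> simp]
    rw [map_add, map_smul, map_smul, Complex.real_smul, Complex.real_smul]
  have h2 : L (-x.2, x.1) = -x.2 * L (1, 0) + x.1 * L (0, 1) := by
    rw [show (-x.2, x.1) = (-x.2) • ((1, 0) : ℝ × ℝ) + x.1 • (0, 1) by ext <;> simp,
      map_add, map_smul, map_smul, Complex.real_smul, Complex.real_smul, Complex.ofReal_neg]
  rw [h1, h2]
  generalize L (1, 0) = a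
  generalize L (0, 1) = b
  have hq : sqnorm x = x.1 ^ 2 + x.2 ^ 2 := rfl
  simp only [← Complex.normSq_eq_norm_sq, Complex.normSq_apply]
  simp
  generalize sqnorm x = q at *
  field_simp
  rw [hq]
  ring

theorem exp_mul_magnetic_density_waveSum {κ : Type*} [Fintype κ] (Φ : ℝ) (ν : κ → ℤ)
    (f : κ → ℝ → ℂ) (hf : ∀ k, Differentiable ℝ (f k)) (s θ : ℝ)
    (hu : DifferentiableAt ℝ (waveSum ν f) (logPolar s θ)) :
    Real.exp (2 * s) * (‖-Complex.I * fderiv ℝ (waveSum ν f) (logPolar s θ) (1, 0) +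
        ((Φ * ((logPolar s θ).2 / sqnorm (logPolar s θ)) : ℝ) : ℂ) *
          waveSum ν f (logPolar s θ)‖ ^ 2 +
      ‖-Complex.I * fderiv ℝ (waveSum ν f) (logPolar s θ) (0, 1) +
        ((Φ * (-(logPolar s θ).1 / sqnorm (logPolar s θ)) : ℝ) : ℂ) *
          waveSum ν f (logPolar s θ)‖ ^ 2) =
    ‖∑ k, Complex.exp (ν k * θ * Complex.I) * deriv (f k) s‖ ^ 2 +
      ‖∑ k, Complex.exp (ν k * θ * Complex.I) * ((ν k - Φ) * f k s)‖ ^ 2 := by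
  rw [← sqnorm_logPolar s θ, sqnorm_mul_magnetic_density Φ
    (by rw [sqnorm_logPolar]; exact (Real.exp_pos _).ne')]
  have h1 : fderiv ℝ (waveSum ν f) (logPolar s θ) (logPolar s θ) =
      ∑ k, Complex.exp (ν k * θ * Complex.I) * deriv (f k) s := by
    have ha := hu.hasFDerivAt.comp_hasDerivAt s (hasDerivAt_logPolar_left s θ)
    have hb : HasDerivAt (waveSum ν f ∘ fun s => logPolar s θ)
        (∑ k, Complex.exp (ν k * θ * Complex.I) * deriv (f k) s) s := by
      have : (waveSum ν f ∘ fun s => logPolar s θ) =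
          fun s => ∑ k, Complex.exp (ν k * θ * Complex.I) * f k s := by
        ext s; exact waveSum_logPolar ν f s θ
      rw [this]
      exact HasDerivAt.fun_sum fun k _ => ((hf k s).hasDerivAt).const_mul _
    exact ha.unique hb
  have h2 : fderiv ℝ (waveSum ν f) (logPolar s θ) (-(logPolar s θ).2, (logPolar s θ).1) =
      ∑ k, Complex.exp (ν k * θ * Complex.I) * (ν k * Complex.I) * f k s := by
    have ha := hu.hasFDerivAt.comp_hasDerivAt θ (hasDerivAt_logPolar_right s θ)
    have hb : HasDerivAt (waveSum ν f ∘ fun θ => logPolar s θ)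
        (∑ k, Complex.exp (ν k * θ * Complex.I) * (ν k * Complex.I) * f k s) θ := by
      have : (waveSum ν f ∘ fun θ => logPolar s θ) =
          fun θ : ℝ => ∑ k, Complex.exp (ν k * θ * Complex.I) * f k s := by
        ext θ; exact waveSum_logPolar ν f s θ
      rw [this]
      refine HasDerivAt.fun_sum fun k _ => HasDerivAt.mul_const ?_ _
      have := (((hasDerivAt_id θ).ofReal_comp.const_mul (ν k : ℂ)).mul_const Complex.I).cexp
      simpa using this
    exact ha.unique hb
  rw [h1, h2, waveSum_logPolar]
  congr 3
  rw [Finset.mul_sum, Finset.mul_sum, ← Finset.sum_sub_distrib]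
  refine Finset.sum_congr rfl fun k _ => ?_
  linear_combination (-Complex.exp (ν k * θ * Complex.I) * ν k * f k s) * Complex.I_mul_I

theorem magEnergy_waveSum {κ : Type*} [Fintype κ] (Φ : ℝ) {ν : κ → ℤ}
    (hν : Function.Injective ν) (f : κ → ℝ → ℂ) (hf : ∀ k, ContDiff ℝ ∞ (f k))
    (hfc : ∀ k, HasCompactSupport (f k)) (hu : Differentiable ℝ (waveSum ν f)) :
    magEnergy Φ (waveSum ν f) =
      2 * Real.pi * ∑ n, ∫ s, (‖deriv (f n) s‖ ^ 2 + (ν n - Φ) ^ 2 * ‖f n s‖ ^ 2) := by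
  have hf' : ∀ k, Continuous (deriv (f k)) := fun k =>
    (contDiff_infty_iff_deriv.1 (hf k)).2.continuous
  have := integral_of_logPolar_expansion hν
    (fun x : ℝ × ℝ =>
    (‖-Complex.I * fderiv ℝ (waveSum ν f) x (1, 0) +
        ((Φ * (x.2 / sqnorm x) : ℝ) : ℂ) * waveSum ν f x‖ ^ 2 +
     ‖-Complex.I * fderiv ℝ (waveSum ν f) x (0, 1) +
        ((Φ * (-x.1 / sqnorm x) : ℝ) : ℂ) * waveSum ν f x‖ ^ 2))
    (fun n k s => deriv (f n) s * (starRingEnd ℂ) (deriv (f k) s) +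
      ((ν n - Φ) * f n s) * (starRingEnd ℂ) ((ν k - Φ) * f k s)) ?_ ?_
  · apply Complex.ofReal_injective
    rw [magEnergy, this]
    push_cast
    congr 1
    refine Finset.sum_congr rfl fun n _ => ?_
    rw [← integral_complex_ofReal]
    refine integral_congr_ae (ae_of_all _ fun s => ?_)
    simp only [Complex.mul_conj']
    have h : ‖(ν n : ℂ) - Φ‖ ^ 2 = ((ν n : ℝ) - Φ) ^ 2 := by
      rw [← Complex.ofReal_intCast, ← Complex.ofReal_sub, Complex.norm_real, Real.norm_eq_abs,
        sq_abs]
    rw [← h, norm_mul]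
    push_cast
    ring
  · intro n k
    refine Continuous.integrable_of_hasCompactSupport ?_ ?_
    · have := (hf n).continuous
      have := (hf k).continuous
      have := hf' n
      have := hf' k
      fun_prop
    · exact ((hfc n).deriv.mul_right).add ((hfc n).mul_left.mul_right)
  · intro s θ
    rw [exp_mul_magnetic_density_waveSum Φ ν f
      (fun k => (hf k).differentiable (by simp)) s θ (hu _), Complex.ofReal_add,
      norm_sq_sum_exp_mul, norm_sq_sum_exp_mul, ← Finset.sum_add_distrib]
    refine Finset.sum_congr rfl fun n _ => ?_
    rw [← Finset.sum_add_distrib]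
    exact Finset.sum_congr rfl fun k _ => by ring

/-- `ψ` is a smooth monotone transition from `0` to `π` on `[a, b]` with slope at most `ρ`. -/
structure IsPhase (a b ρ : ℝ) (ψ : ℝ → ℝ) : Prop where
  contDiff : ContDiff ℝ ∞ ψ
  rho_pos : 0 < ρ
  deriv_nonneg : ∀ s, 0 ≤ deriv ψ s
  deriv_le : ∀ s, deriv ψ s ≤ ρ
  eq_zero : ∀ s, s ≤ a → ψ s = 0
  eq_pi : ∀ s, b ≤ s → ψ s = Real.pi
  deriv_eq_zero : ∀ s, s ∉ Set.Ioo a b → deriv ψ s = 0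

theorem exists_isPhase (a : ℝ) {l : ℝ} (hl : 1 < l) :
    ∃ ψ ρ, ρ ≤ Real.pi / (l - 1) ∧ IsPhase a (a + l) ρ ψ := by
  let β : ContDiffBump (a + l / 2) := ⟨(l - 1) / 2, l / 2, by linarith, by linarith⟩
  have hβc : Continuous β := β.continuous
  have hβ0 : ∀ s, s ∉ Set.Ioo a (a + l) → β s = 0 := by
    intro s hs
    apply β.zero_of_le_dist
    change l / 2 ≤ dist s (a + l / 2)
    rw [Real.dist_eq]
    by_contra! h
    rw [abs_lt] at h
    exact hs ⟨by linarith, by linarith⟩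
  set m : ℝ := ∫ s in a..(a + l), β s with hm
  have hmle : l - 1 ≤ m := by
    have h1 : ∫ s in (a + 1 / 2)..(a + l - 1 / 2), β s = l - 1 := by
      rw [intervalIntegral.integral_congr (g := fun _ => (1 : ℝ))]
      · simp; ring
      · intro s hs
        rw [Set.uIcc_of_le (by linarith)] at hs
        apply β.one_of_mem_closedBall
        change dist s (a + l / 2) ≤ (l - 1) / 2
        rw [Real.dist_eq, abs_le]
        constructor <;> linarith [hs.1, hs.2]
    rw [← h1]
    exact intervalIntegral.integral_mono_interval (by linarith) (by linarith) (by linarith)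
      (ae_of_all _ fun s => β.nonneg) (hβc.intervalIntegrable _ _)
  have hm0 : 0 < m := by linarith
  have hder : ∀ s, HasDerivAt (fun s => Real.pi / m * ∫ x in a..s, β x) (Real.pi / m * β s) s :=
    fun s => (intervalIntegral.integral_hasDerivAt_right (hβc.intervalIntegrable _ _)
      (hβc.stronglyMeasurableAtFilter _ _) hβc.continuousAt).const_mul _
  have hρ : 0 < Real.pi / m := div_pos Real.pi_pos hm0
  refine ⟨fun s => Real.pi / m * ∫ x in a..s, β x, Real.pi / m, ?_, ?_, hρ, ?_, ?_, ?_, ?_, ?_⟩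
  · exact div_le_div_of_nonneg_left Real.pi_pos.le (by linarith) hmle
  · refine contDiff_infty_iff_deriv.2 ⟨fun s => (hder s).differentiableAt, ?_⟩
    rw [funext fun s => (hder s).deriv]
    exact contDiff_const.mul β.contDiff
  · intro s
    rw [(hder s).deriv]
    exact mul_nonneg hρ.le β.nonneg
  · intro s
    rw [(hder s).deriv]
    exact mul_le_of_le_one_right hρ.le β.le_one
  · intro s hs
    rw [intervalIntegral.integral_congr (g := fun _ => (0 : ℝ))]
    · simp
    · intro x hx
      rw [Set.uIcc_of_ge hs] at hx
      exact hβ0 x fun h => by linarith [h.1, hx.2]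
  · intro s hs
    have h2 : ∫ x in (a + l)..s, β x = 0 := by
      rw [intervalIntegral.integral_congr (g := fun _ => (0 : ℝ))]
      · simp
      · intro x hx
        rw [Set.uIcc_of_le hs] at hx
        exact hβ0 x fun h => by linarith [h.2, hx.1]
    rw [← intervalIntegral.integral_add_adjacent_intervals (hβc.intervalIntegrable a (a + l))
      (hβc.intervalIntegrable _ _), h2, ← hm, add_zero]
    field_simp
  · intro s hs
    rw [(hder s).deriv, hβ0 s hs, mul_zero]

theorem integral_cos_int_mul (n : ℤ) :
    ∫ x in (0 : ℝ)..Real.pi, Real.cos (n * x) = if n = 0 then Real.pi else 0 := by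
  split_ifs with h
  · simp [h]
  · rw [intervalIntegral.integral_comp_mul_left (fun x => Real.cos x) (by exact_mod_cast h)]
    simp

theorem integral_sin_mul_sin (j k : ℕ) :
    ∫ x in (0 : ℝ)..Real.pi, Real.sin ((j + 1) * x) * Real.sin ((k + 1) * x) =
      if j = k then Real.pi / 2 else 0 := by
  have h : ∀ x : ℝ, Real.sin ((j + 1) * x) * Real.sin ((k + 1) * x) =
      (Real.cos (((j - k : ℤ) : ℝ) * x) - Real.cos (((j + k + 2 : ℤ) : ℝ) * x)) / 2 := by
    intro x
    rw [show (((j - k : ℤ) : ℝ) * x) = (j + 1) * x - (k + 1) * x by push_cast; ring,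
      show (((j + k + 2 : ℤ) : ℝ) * x) = (j + 1) * x + (k + 1) * x by push_cast; ring,
      Real.cos_sub, Real.cos_add]
    ring
  simp only [h]
  rw [intervalIntegral.integral_div, intervalIntegral.integral_sub
    (Continuous.intervalIntegrable (by fun_prop) _ _)
    (Continuous.intervalIntegrable (by fun_prop) _ _), integral_cos_int_mul, integral_cos_int_mul,
    if_neg (show (j + k + 2 : ℤ) ≠ 0 by omega)]
  by_cases hjk : j = k
  · simp [hjk]
  · rw [if_neg (by omega), if_neg hjk]; simp

theorem integral_cos_mul_cos (j k : ℕ) :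
    ∫ x in (0 : ℝ)..Real.pi, Real.cos ((j + 1) * x) * Real.cos ((k + 1) * x) =
      if j = k then Real.pi / 2 else 0 := by
  have h : ∀ x : ℝ, Real.cos ((j + 1) * x) * Real.cos ((k + 1) * x) =
      (Real.cos (((j - k : ℤ) : ℝ) * x) + Real.cos (((j + k + 2 : ℤ) : ℝ) * x)) / 2 := by
    intro x
    rw [show (((j - k : ℤ) : ℝ) * x) = (j + 1) * x - (k + 1) * x by push_cast; ring,
      show (((j + k + 2 : ℤ) : ℝ) * x) = (j + 1) * x + (k + 1) * x by push_cast; ring,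
      Real.cos_sub, Real.cos_add]
    ring
  simp only [h]
  rw [intervalIntegral.integral_div, intervalIntegral.integral_add
    (Continuous.intervalIntegrable (by fun_prop) _ _)
    (Continuous.intervalIntegrable (by fun_prop) _ _), integral_cos_int_mul, integral_cos_int_mul,
    if_neg (show (j + k + 2 : ℤ) ≠ 0 by omega)]
  by_cases hjk : j = k
  · simp [hjk]
  · rw [if_neg (by omega), if_neg hjk]; simp

theorem integral_norm_sq_sum_orthogonal {J : ℕ} (φ : ℕ → ℝ → ℝ) (hφ : ∀ j, Continuous (φ j))
    (horth : ∀ j k, ∫ x in (0 : ℝ)..Real.pi, φ j x * φ k x = if j = k then Real.pi / 2 else 0)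
    (c : Fin J → ℂ) :
    ∫ x in (0 : ℝ)..Real.pi, ‖∑ j, c j * (φ j x : ℂ)‖ ^ 2 = Real.pi / 2 * ∑ j, ‖c j‖ ^ 2 := by
  apply Complex.ofReal_injective
  rw [← intervalIntegral.integral_ofReal]
  have h : ∀ x, ((‖∑ j, c j * (φ j x : ℂ)‖ ^ 2 : ℝ) : ℂ) =
      ∑ j, ∑ k, c j * (starRingEnd ℂ) (c k) * ((φ j x * φ k x : ℝ) : ℂ) := by
    intro x
    rw [Complex.ofReal_pow, ← Complex.mul_conj', map_sum, Finset.sum_mul_sum]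
    refine Finset.sum_congr rfl fun j _ => Finset.sum_congr rfl fun k _ => ?_
    rw [map_mul, Complex.conj_ofReal, Complex.ofReal_mul]
    ring
  have hc : ∀ j k : Fin J, Continuous fun x =>
      c j * (starRingEnd ℂ) (c k) * ((φ j x * φ k x : ℝ) : ℂ) := by
    intro j k
    have := hφ j
    have := hφ k
    fun_prop
  simp only [h]
  rw [intervalIntegral.integral_finsetSum fun j _ => (continuous_finsetSum _
    fun k _ => hc j k).intervalIntegrable _ _, Complex.ofReal_mul, Complex.ofReal_sum,
    Finset.mul_sum]
  refine Finset.sum_congr rfl fun j _ => ?_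
  rw [intervalIntegral.integral_finsetSum fun k _ => (hc j k).intervalIntegrable _ _,
    Finset.sum_eq_single j]
  · rw [intervalIntegral.integral_const_mul, intervalIntegral.integral_ofReal, horth, if_pos rfl,
      Complex.mul_conj']
    push_cast; ring
  · intro k _ hk
    rw [intervalIntegral.integral_const_mul, intervalIntegral.integral_ofReal, horth,
      if_neg fun h => hk (Fin.ext h).symm]
    simp
  · simp

/-- A superposition of sine modes in the phase `ψ`. -/
noncomputable def packet {J : ℕ} (ψ : ℝ → ℝ) (c : Fin J → ℂ) (s : ℝ) : ℂ :=
  ∑ j, c j * (Real.sin (((j : ℕ) + 1) * ψ s) : ℂ)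

namespace IsPhase

variable {a b ρ : ℝ} {ψ : ℝ → ℝ} {J : ℕ}

theorem contDiff_packet (h : IsPhase a b ρ ψ) (c : Fin J → ℂ) : ContDiff ℝ ∞ (packet ψ c) := by
  unfold packet
  refine ContDiff.sum fun j _ => contDiff_const.mul ?_
  exact Complex.ofRealCLM.contDiff.comp (Real.contDiff_sin.comp (contDiff_const.mul h.contDiff))

theorem packet_eq_zero (h : IsPhase a b ρ ψ) (c : Fin J → ℂ) {s : ℝ} (hs : s ∉ Set.Ioo a b) :
    packet ψ c s = 0 := by
  refine Finset.sum_eq_zero fun j _ => ?_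
  have : Real.sin (((j : ℕ) + 1) * ψ s) = 0 := by
    rcases le_or_gt s a with h1 | h1
    · simp [h.eq_zero s h1]
    · have h2 : b ≤ s := by by_contra! h3; exact hs ⟨h1, h3⟩
      rw [h.eq_pi s h2]
      exact_mod_cast Real.sin_nat_mul_pi (j + 1)
  rw [this]; simp

theorem deriv_packet (h : IsPhase a b ρ ψ) (c : Fin J → ℂ) (s : ℝ) :
    deriv (packet ψ c) s = ((deriv ψ s : ℝ) : ℂ) *
      ∑ j : Fin J, (c j * ((j : ℕ) + 1)) * (Real.cos (((j : ℕ) + 1) * ψ s) : ℂ) := by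
  have hψ : HasDerivAt ψ (deriv ψ s) s :=
    ((h.contDiff.differentiable (by simp)) s).hasDerivAt
  have : HasDerivAt (packet ψ c) (∑ j : Fin J, c j * ((Real.cos (((j : ℕ) + 1) * ψ s) *
      (((j : ℕ) + 1) * deriv ψ s) : ℝ) : ℂ)) s :=
    HasDerivAt.fun_sum fun j _ => (((hψ.const_mul _).sin).ofReal_comp).const_mul _
  rw [this.deriv, Finset.mul_sum]
  refine Finset.sum_congr rfl fun j _ => ?_
  push_cast; ring

theorem deriv_packet_eq_zero (h : IsPhase a b ρ ψ) (c : Fin J → ℂ) {s : ℝ}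
    (hs : s ∉ Set.Ioo a b) : deriv (packet ψ c) s = 0 := by
  rw [h.deriv_packet, h.deriv_eq_zero s hs]; simp

theorem integral_deriv_mul_comp (h : IsPhase a b ρ ψ) {g : ℝ → ℝ}
    (hg : Continuous g) :
    ∫ s in a..b, deriv ψ s * g (ψ s) = ∫ x in (0 : ℝ)..Real.pi, g x := by
  have hd := contDiff_infty_iff_deriv.1 h.contDiff
  have := intervalIntegral.integral_comp_mul_deriv (a := a) (b := b) (f := ψ) (f' := deriv ψ)
    (g := g) (fun x _ => (hd.1 x).hasDerivAt) hd.2.continuous.continuousOn hg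
  rw [h.eq_zero a le_rfl, h.eq_pi b le_rfl] at this
  rw [← this]
  simp [mul_comm]

theorem integral_packet_le (h : IsPhase a b ρ ψ) (hab : a ≤ b) (c : Fin J → ℂ) {W : ℝ → ℝ}
    (hW : ContinuousOn W (Set.Icc a b)) {t μ : ℝ} (ht : ∀ s ∈ Set.Icc a b, t ≤ W s)
    (hJ : ∀ j : Fin J, ρ ^ 2 * ((j : ℕ) + 1) ^ 2 + μ ^ 2 < t) :
    ∫ s, (‖deriv (packet ψ c) s‖ ^ 2 + μ ^ 2 * ‖packet ψ c s‖ ^ 2 - W s * ‖packet ψ c s‖ ^ 2) ≤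
      Real.pi / (2 * ρ) * ∑ j : Fin J, ‖c j‖ ^ 2 * (ρ ^ 2 * ((j : ℕ) + 1) ^ 2 + μ ^ 2 - t) := by
  have hd := contDiff_infty_iff_deriv.1 h.contDiff
  have hψc := h.contDiff.continuous
  have hψ'c := hd.2.continuous
  have hpd := contDiff_infty_iff_deriv.1 (h.contDiff_packet c)
  have hpc := (h.contDiff_packet c).continuous
  have hp'c := hpd.2.continuous
  set S : ℝ → ℝ := fun x => ‖∑ j : Fin J, c j * (Real.sin (((j : ℕ) + 1) * x) : ℂ)‖ ^ 2 with hS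
  set C : ℝ → ℝ := fun x =>
    ‖∑ j : Fin J, (c j * ((j : ℕ) + 1)) * (Real.cos (((j : ℕ) + 1) * x) : ℂ)‖ ^ 2 with hC
  have hSc : Continuous S := by fun_prop
  have hCc : Continuous C := by fun_prop
  have hSi : ∫ x in (0 : ℝ)..Real.pi, S x = Real.pi / 2 * ∑ j, ‖c j‖ ^ 2 :=
    integral_norm_sq_sum_orthogonal (fun j x => Real.sin ((j + 1) * x)) (fun j => by fun_prop)
      integral_sin_mul_sin c
  have hCi : ∫ x in (0 : ℝ)..Real.pi, C x =
      Real.pi / 2 * ∑ j : Fin J, ‖c j * ((j : ℕ) + 1)‖ ^ 2 :=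
    integral_norm_sq_sum_orthogonal (fun j x => Real.cos ((j + 1) * x)) (fun j => by fun_prop)
      integral_cos_mul_cos (fun j : Fin J => c j * ((j : ℕ) + 1))
  have hρ := h.rho_pos
  have hcase : IsEmpty (Fin J) ∨ μ ^ 2 ≤ t := by
    rcases isEmpty_or_nonempty (Fin J) with h1 | ⟨⟨j⟩⟩
    · exact Or.inl h1
    · right
      have := hJ j
      nlinarith [mul_nonneg (sq_nonneg ρ) (sq_nonneg (((j : ℕ) : ℝ) + 1))]
  rcases hcase with hE | hμt
  · have hz : packet ψ c = fun _ => 0 := by ext s; simp [packet]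
    simp [hz]
  have hpt : ∀ s ∈ Set.Icc a b,
      ‖deriv (packet ψ c) s‖ ^ 2 + μ ^ 2 * ‖packet ψ c s‖ ^ 2 - W s * ‖packet ψ c s‖ ^ 2 ≤
        deriv ψ s * (ρ * C (ψ s) + (μ ^ 2 - t) / ρ * S (ψ s)) := by
    intro s hs
    have e1 : ‖deriv (packet ψ c) s‖ ^ 2 = deriv ψ s ^ 2 * C (ψ s) := by
      rw [h.deriv_packet, norm_mul, mul_pow, Complex.norm_real, Real.norm_eq_abs, sq_abs]
    have e2 : ‖packet ψ c s‖ ^ 2 = S (ψ s) := rfl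
    have hSn : 0 ≤ S (ψ s) := sq_nonneg _
    have hCn : 0 ≤ C (ψ s) := sq_nonneg _
    have h0 := h.deriv_nonneg s
    have h1 := h.deriv_le s
    rw [e1, e2]
    have i1 : deriv ψ s ^ 2 * C (ψ s) ≤ deriv ψ s * (ρ * C (ψ s)) := by
      nlinarith [mul_nonneg (mul_nonneg h0 (sub_nonneg.2 h1)) hCn]
    have i2 : (t - μ ^ 2) * S (ψ s) ≤ (W s - μ ^ 2) * S (ψ s) :=
      mul_le_mul_of_nonneg_right (by linarith [ht s hs]) hSn
    have i3 : deriv ψ s / ρ * ((t - μ ^ 2) * S (ψ s)) ≤ (t - μ ^ 2) * S (ψ s) :=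
      mul_le_of_le_one_left (mul_nonneg (by linarith) hSn) ((div_le_one hρ).2 h1)
    have i4 : deriv ψ s * ((μ ^ 2 - t) / ρ * S (ψ s)) =
        -(deriv ψ s / ρ * ((t - μ ^ 2) * S (ψ s))) := by ring
    linarith
  have hsupp : ∀ s, s ∉ Set.Ioc a b →
      ‖deriv (packet ψ c) s‖ ^ 2 + μ ^ 2 * ‖packet ψ c s‖ ^ 2 - W s * ‖packet ψ c s‖ ^ 2 = 0 := by
    intro s hs
    have hs' : s ∉ Set.Ioo a b := fun h => hs ⟨h.1, h.2.le⟩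
    rw [h.packet_eq_zero c hs', h.deriv_packet_eq_zero c hs']; simp
  rw [← setIntegral_eq_integral_of_forall_compl_eq_zero hsupp,
    ← intervalIntegral.integral_of_le hab]
  have hint : IntervalIntegrable (fun s => ‖deriv (packet ψ c) s‖ ^ 2 +
      μ ^ 2 * ‖packet ψ c s‖ ^ 2 - W s * ‖packet ψ c s‖ ^ 2) volume a b := by
    apply ContinuousOn.intervalIntegrable
    rw [Set.uIcc_of_le hab]
    exact (Continuous.continuousOn (by fun_prop)).sub
      (hW.mul (Continuous.continuousOn (by fun_prop)))
  calc _ ≤ ∫ s in a..b, deriv ψ s * (ρ * C (ψ s) + (μ ^ 2 - t) / ρ * S (ψ s)) :=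
        intervalIntegral.integral_mono_on hab hint
          (Continuous.intervalIntegrable (by fun_prop) _ _) hpt
    _ = ∫ x in (0 : ℝ)..Real.pi, (ρ * C x + (μ ^ 2 - t) / ρ * S x) :=
        h.integral_deriv_mul_comp (g := fun x => ρ * C x + (μ ^ 2 - t) / ρ * S x)
          (by fun_prop)
    _ = _ := by
        rw [intervalIntegral.integral_add (Continuous.intervalIntegrable (by fun_prop) _ _)
          (Continuous.intervalIntegrable (by fun_prop) _ _), intervalIntegral.integral_const_mul,
          intervalIntegral.integral_const_mul, hSi, hCi, Finset.mul_sum, Finset.mul_sum,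
          Finset.mul_sum, Finset.mul_sum, Finset.mul_sum, ← Finset.sum_add_distrib]
        refine Finset.sum_congr rfl fun j _ => ?_
        have : ‖((j : ℕ) : ℂ) + 1‖ = ((j : ℕ) : ℝ) + 1 := by
          exact_mod_cast Complex.norm_natCast ((j : ℕ) + 1)
        rw [norm_mul, this]
        field_simp
        ring

end IsPhase

/-- The decreasing power profile `(s / K) ^ (-1/p)` on the half-line. -/
noncomputable def powerProfile (p K s : ℝ) : ℝ := if 0 < s then (s / K) ^ (-p⁻¹) else 0

/-- The radial potential with logarithmic profile `powerProfile p K`. -/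
noncomputable def powerPotential (p K : ℝ) (x : ℝ × ℝ) : ℝ :=
  (sqnorm x)⁻¹ * powerProfile p K (logRad x)

theorem measurable_logRad : Measurable logRad :=
  (Real.measurable_log.comp continuous_sqnorm.measurable).div_const 2

theorem measurable_powerPotential (p K : ℝ) : Measurable (powerPotential p K) := by
  have h : Measurable (powerProfile p K) :=
    Measurable.ite measurableSet_Ioi (by fun_prop) measurable_const
  exact continuous_sqnorm.measurable.inv.mul (h.comp measurable_logRad)

theorem continuousOn_powerProfile (p : ℝ) {K : ℝ} (hK : 0 < K) :
    ContinuousOn (powerProfile p K) (Set.Ioi 0) := by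
  have : ContinuousOn (fun s : ℝ => (s / K) ^ (-p⁻¹)) (Set.Ioi 0) :=
    (continuousOn_id.div_const K).rpow_const fun s hs => Or.inl (div_pos hs hK).ne'
  exact this.congr fun s hs => if_pos hs

theorem lintegral_annulus (T : ℝ) :
    ∫⁻ x in {x : ℝ × ℝ | 0 < logRad x ∧ logRad x < T}, ENNReal.ofReal (sqnorm x)⁻¹ =
      ENNReal.ofReal T * ENNReal.ofReal (2 * Real.pi) := by
  have hS : MeasurableSet {x : ℝ × ℝ | 0 < logRad x ∧ logRad x < T} :=
    measurable_logRad measurableSet_Ioo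
  set g : ℝ → ℝ≥0∞ := (Set.Ioo 0 T).indicator fun _ => 1 with hg
  have hgm : Measurable g := measurable_const.indicator measurableSet_Ioo
  have hpt : ∀ q ∈ polarCoord.target, ENNReal.ofReal q.1 •
      ({x : ℝ × ℝ | 0 < logRad x ∧ logRad x < T}.indicator
        (fun x => ENNReal.ofReal (sqnorm x)⁻¹) (polarCoord.symm q)) =
      (g (Real.log q.1) * ENNReal.ofReal q.1⁻¹) * 1 := by
    intro q hq
    have hq1 : 0 < q.1 := by simpa using hq.1
    have h1 : polarCoord.symm q = logPolar (Real.log q.1) q.2 := by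
      simp [logPolar, Real.exp_log hq1]
    have h2 : Real.exp (2 * Real.log q.1) = q.1 * q.1 := by
      rw [two_mul, Real.exp_add, Real.exp_log hq1]
    rw [h1, hg]
    simp only [Set.indicator_apply, Set.mem_ofPred_eq, logRad_logPolar, sqnorm_logPolar, h2,
      Set.mem_Ioo, smul_eq_mul, mul_one]
    split_ifs
    · rw [one_mul, ← ENNReal.ofReal_mul hq1.le]
      congr 1
      field_simp
    · simp
  rw [← lintegral_indicator hS, ← lintegral_comp_polarCoord_symm,
    setLIntegral_congr_fun polarCoord.open_target.measurableSet hpt, polarCoord_target,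
    Measure.volume_eq_prod, ← Measure.prod_restrict,
    lintegral_prod_mul (f := fun r => g (Real.log r) * ENNReal.ofReal r⁻¹) (g := fun _ => 1)
      (by fun_prop) (by fun_prop)]
  congr 1
  · rw [← image_exp_univ, lintegral_image_eq_lintegral_abs_deriv_mul MeasurableSet.univ
      (fun x _ => (Real.hasDerivAt_exp x).hasDerivWithinAt) Real.exp_injective.injOn]
    have : ∀ s : ℝ, ENNReal.ofReal |Real.exp s| *
        (g (Real.log (Real.exp s)) * ENNReal.ofReal (Real.exp s)⁻¹) = g s := by
      intro s
      rw [Real.log_exp, mul_left_comm, ← ENNReal.ofReal_mul (abs_nonneg _),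
        abs_of_pos (Real.exp_pos s), mul_inv_cancel₀ (Real.exp_pos s).ne']
      simp
    simp only [this, setLIntegral_univ]
    rw [hg, lintegral_indicator measurableSet_Ioo]
    simp
  · simp [two_mul]

theorem weakNorm_powerPotential_le {α K : ℝ} (hα : 0 < α) (hK : 0 < K) :
    weakNorm α (powerPotential (1 + α / 2) K) ≤ ENNReal.ofReal (2 * Real.pi * K) := by
  refine iSup₂_le fun t ht => ?_
  have hp : 0 < 1 + α / 2 := by linarith
  generalize 1 + α / 2 = p at *
  have hsub : {x : ℝ × ℝ | t < sqnorm x * max (powerPotential p K x) 0} ⊆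
      {x : ℝ × ℝ | 0 < logRad x ∧ logRad x < K * t ^ (-p)} := by
    intro x hx
    simp only [Set.mem_ofPred_eq] at hx ⊢
    by_cases hs : 0 < logRad x
    · refine ⟨hs, ?_⟩
      have hq : sqnorm x ≠ 0 := by
        intro h
        simp [logRad, h] at hs
      have hw : 0 < (logRad x / K) ^ (-p⁻¹) := by positivity
      have hV : 0 ≤ powerPotential p K x := by
        rw [powerPotential, powerProfile, if_pos hs]
        exact mul_nonneg (inv_nonneg.2 (sqnorm_nonneg x)) hw.le
      rw [max_eq_left hV, powerPotential, powerProfile, if_pos hs, mul_inv_cancel_left₀ hq] at hx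
      have h1 := Real.rpow_lt_rpow_of_neg ht hx (neg_neg_of_pos hp)
      rw [← Real.rpow_mul (by positivity), neg_mul_neg, inv_mul_cancel₀ hp.ne', Real.rpow_one,
        div_lt_iff₀ hK] at h1
      linarith
    · rw [powerPotential, powerProfile, if_neg hs] at hx
      simp at hx
      linarith
  calc _ ≤ ENNReal.ofReal (t ^ p) * (ENNReal.ofReal (K * t ^ (-p)) *
        ENNReal.ofReal (2 * Real.pi)) := by
        gcongr
        exact (lintegral_mono_set hsub).trans_eq (lintegral_annulus _)
    _ = _ := by
        rw [← ENNReal.ofReal_mul (by positivity), ← ENNReal.ofReal_mul (by positivity)]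
        congr 1
        have : t ^ p * t ^ (-p) = 1 := by rw [← Real.rpow_add ht]; simp
        linear_combination (2 * Real.pi * K) * this

theorem norm_sq_sum_of_disjoint {ι : Type*} [Fintype ι] (z : ι → ℂ)
    (h : ∀ i j, i ≠ j → z i = 0 ∨ z j = 0) : ‖∑ i, z i‖ ^ 2 = ∑ i, ‖z i‖ ^ 2 := by
  by_cases h0 : ∀ i, z i = 0
  · simp [h0]
  · push Not at h0
    obtain ⟨i, hi⟩ := h0
    have hz : ∀ j, j ≠ i → z j = 0 := fun j hj => (h j i hj).resolve_right hi
    rw [Finset.sum_eq_single i (fun j _ hj => hz j hj) (by simp),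
      Finset.sum_eq_single i (fun j _ hj => by simp [hz j hj]) (by simp)]

theorem integrable_smul_of_eq_zero_outside {E : Type*} [NormedAddCommGroup E] [NormedSpace ℝ E]
    {W : ℝ → ℝ} {A B : ℝ} (hW : ContinuousOn W (Set.Icc A B)) {g : ℝ → E} (hg : Continuous g)
    (hg0 : ∀ s, s ∉ Set.Icc A B → g s = 0) : Integrable fun s => W s • g s := by
  rw [← integrableOn_iff_integrable_of_support_subset (s := Set.Icc A B)]
  · exact (hW.smul hg.continuousOn).integrableOn_Icc
  · intro s hs
    by_contra h
    exact hs (by simp [hg0 s h])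

/-- The radial profiles attached to a family of coefficients. -/
noncomputable def profile {κ : Type*} {P : ℕ} {J : κ → Fin P → ℕ} (ψ : Fin P → ℝ → ℝ)
    (c : (Σ k, Σ i, Fin (J k i)) → ℂ) (k : κ) (s : ℝ) : ℂ :=
  ∑ i, packet (ψ i) (fun j => c ⟨k, i, j⟩) s

/-- The trial functions, as a linear function of their coefficients. -/
noncomputable def trialMap {κ : Type*} [Fintype κ] {P : ℕ} (J : κ → Fin P → ℕ)
    (ψ : Fin P → ℝ → ℝ) (ν : κ → ℤ) :
    ((Σ k, Σ i, Fin (J k i)) → ℂ) →ₗ[ℂ] (ℝ × ℝ → ℂ) where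
  toFun c := waveSum ν (profile ψ c)
  map_add' c d := by
    ext x
    simp [waveSum, profile, packet, add_mul, mul_add, Finset.sum_add_distrib]
  map_smul' r c := by
    ext x
    simp only [waveSum, profile, packet, Pi.smul_apply, smul_eq_mul, RingHom.id_apply,
      Finset.mul_sum]
    refine Finset.sum_congr rfl fun k _ => Finset.sum_congr rfl fun i _ =>
      Finset.sum_congr rfl fun j _ => ?_
    ring

section Trial

variable {κ : Type*} {P : ℕ} {J : κ → Fin P → ℕ} {ψ : Fin P → ℝ → ℝ} {ν : κ → ℤ}
  {ρ : Fin P → ℝ} {A l : ℝ}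

theorem disjoint_phase_intervals (hl : 0 < l) {i j : Fin P} (hij : i ≠ j) (s : ℝ) :
    s ∉ Set.Ioo (A + (i : ℕ) * l) (A + (i : ℕ) * l + l) ∨
      s ∉ Set.Ioo (A + (j : ℕ) * l) (A + (j : ℕ) * l + l) := by
  by_contra! h
  obtain ⟨⟨h1, h2⟩, h3, h4⟩ := h
  have h5 : ((i : ℕ) : ℝ) < (j : ℕ) + 1 := by
    by_contra! h6
    nlinarith
  have h6 : ((j : ℕ) : ℝ) < (i : ℕ) + 1 := by
    by_contra! h6
    nlinarith
  norm_cast at h5 h6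
  exact hij (Fin.ext (by omega))

theorem phase_interval_subset (hl : 0 < l) (i : Fin P) :
    Set.Ioo (A + (i : ℕ) * l) (A + (i : ℕ) * l + l) ⊆ Set.Icc A (A + P * l) := by
  intro s hs
  have h1 : (0 : ℝ) ≤ (i : ℕ) * l := by positivity
  have h2 : (((i : ℕ) : ℝ) + 1) * l ≤ P * l := by
    gcongr
    exact_mod_cast i.2
  exact ⟨by linarith [hs.1], by linarith [hs.2]⟩

theorem contDiff_profile
    (hψ : ∀ i : Fin P, IsPhase (A + (i : ℕ) * l) (A + (i : ℕ) * l + l) (ρ i) (ψ i))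
    (c : (Σ k, Σ i, Fin (J k i)) → ℂ) (k : κ) : ContDiff ℝ ∞ (profile ψ c k) := by
  unfold profile
  exact ContDiff.sum fun i _ => (hψ i).contDiff_packet _

theorem profile_eq_zero (hl : 0 < l)
    (hψ : ∀ i : Fin P, IsPhase (A + (i : ℕ) * l) (A + (i : ℕ) * l + l) (ρ i) (ψ i))
    (c : (Σ k, Σ i, Fin (J k i)) → ℂ) (k : κ) {s : ℝ} (hs : s ∉ Set.Icc A (A + P * l)) :
    profile ψ c k s = 0 :=
  Finset.sum_eq_zero fun i _ =>
    (hψ i).packet_eq_zero _ fun h => hs (phase_interval_subset hl i h)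

theorem isTestFun_trialMap [Fintype κ] (hl : 0 < l) (hA : 0 < A)
    (hψ : ∀ i : Fin P, IsPhase (A + (i : ℕ) * l) (A + (i : ℕ) * l + l) (ρ i) (ψ i))
    (c : (Σ k, Σ i, Fin (J k i)) → ℂ) : IsTestFun (trialMap J ψ ν c) := by
  refine isTestFun_waveSum ν _ (fun k => contDiff_profile hψ c k) (B := A + P * l + 1)
    (fun k s hs => ?_) fun k s hs => ?_
  · exact profile_eq_zero hl hψ c k fun h => by linarith [h.1]
  · exact profile_eq_zero hl hψ c k fun h => by linarith [h.2]

theorem magEnergy_trialMap_lt [Fintype κ] (Φ : ℝ) (hν : Function.Injective ν) {p K : ℝ} (hp : 0 < p)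
    (hK : 0 < K) (hl : 0 < l) (hA : 0 < A)
    (hψ : ∀ i : Fin P, IsPhase (A + (i : ℕ) * l) (A + (i : ℕ) * l + l) (ρ i) (ψ i))
    (hJ : ∀ k (i : Fin P) (j : Fin (J k i)),
      ρ i ^ 2 * ((j : ℕ) + 1) ^ 2 + (ν k - Φ) ^ 2 < ((A + (i : ℕ) * l + l) / K) ^ (-p⁻¹))
    {c : (Σ k, Σ i, Fin (J k i)) → ℂ} (hc : c ≠ 0) :
    magEnergy Φ (trialMap J ψ ν c) <
      ∫ x : ℝ × ℝ, powerPotential p K x * ‖trialMap J ψ ν c x‖ ^ 2 := by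
  set f := profile ψ c with hf
  set W := powerProfile p K with hW
  set q : κ → Fin P → ℝ → ℂ := fun k i => packet (ψ i) (fun j => c ⟨k, i, j⟩) with hq
  have hWc : ContinuousOn W (Set.Icc A (A + P * l)) :=
    (continuousOn_powerProfile p hK).mono fun s hs => lt_of_lt_of_le hA hs.1
  have hfd : ∀ k, ContDiff ℝ ∞ (f k) := fun k => contDiff_profile hψ c k
  have hfc : ∀ k, Continuous (f k) := fun k => (hfd k).continuous
  have hf0 : ∀ k s, s ∉ Set.Icc A (A + P * l) → f k s = 0 :=
    fun k s hs => profile_eq_zero hl hψ c k hs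
  have hfcs : ∀ k, HasCompactSupport (f k) := fun k =>
    HasCompactSupport.intro isCompact_Icc (hf0 k)
  have hf'c : ∀ k, Continuous (deriv (f k)) := fun k =>
    (contDiff_infty_iff_deriv.1 (hfd k)).2.continuous
  have hqd : ∀ k i, ContDiff ℝ ∞ (q k i) := fun k i => (hψ i).contDiff_packet _
  have hqc : ∀ k i, Continuous (q k i) := fun k i => (hqd k i).continuous
  have hq'c : ∀ k i, Continuous (deriv (q k i)) := fun k i =>
    (contDiff_infty_iff_deriv.1 (hqd k i)).2.continuous
  have hq0 : ∀ k i s, s ∉ Set.Icc A (A + P * l) → q k i s = 0 := fun k i s hs =>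
    (hψ i).packet_eq_zero _ fun h => hs (phase_interval_subset hl i h)
  have hqcs : ∀ k i, HasCompactSupport (q k i) := fun k i =>
    HasCompactSupport.intro isCompact_Icc (hq0 k i)
  have hkin : ∀ (g : ℝ → ℂ) (μ : ℝ), Continuous g → Continuous (deriv g) → HasCompactSupport g →
      Integrable fun s => ‖deriv g s‖ ^ 2 + μ ^ 2 * ‖g s‖ ^ 2 := by
    intro g μ hg hg' hgs
    refine Continuous.integrable_of_hasCompactSupport (by fun_prop) ?_
    have h1 : HasCompactSupport fun s => ‖deriv g s‖ ^ 2 :=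
      hgs.deriv.comp_left (g := fun z => ‖z‖ ^ 2) (by simp)
    have h2 : HasCompactSupport fun s => μ ^ 2 * ‖g s‖ ^ 2 :=
      hgs.comp_left (g := fun z => μ ^ 2 * ‖z‖ ^ 2) (by simp)
    exact h1.add h2
  have hpot : ∀ g : ℝ → ℂ, Continuous g → (∀ s, s ∉ Set.Icc A (A + P * l) → g s = 0) →
      Integrable fun s => W s * ‖g s‖ ^ 2 := by
    intro g hg hg0
    exact integrable_smul_of_eq_zero_outside hWc (g := fun s => ‖g s‖ ^ 2) (by fun_prop)
      fun s hs => by simp [hg0 s hs]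
  have hE := magEnergy_waveSum Φ hν f hfd hfcs
    ((isTestFun_trialMap hl hA hψ c).1.differentiable (by simp))
  have hV := integral_potential_waveSum hν f W fun n k => by
    have := integrable_smul_of_eq_zero_outside hWc
      (g := fun s => f n s * (starRingEnd ℂ) (f k s))
      ((hfc n).mul (Complex.continuous_conj.comp (hfc k))) fun s hs => by simp [hf0 n s hs]
    simpa only [Complex.real_smul] using this
  have hdisj : ∀ k s, ∀ i j, i ≠ j → q k i s = 0 ∨ q k j s = 0 := by
    intro k s i j hij
    exact (disjoint_phase_intervals hl hij s).imp (fun h => (hψ i).packet_eq_zero _ h)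
      fun h => (hψ j).packet_eq_zero _ h
  have hdisj' : ∀ k s, ∀ i j, i ≠ j → deriv (q k i) s = 0 ∨ deriv (q k j) s = 0 := by
    intro k s i j hij
    exact (disjoint_phase_intervals hl hij s).imp (fun h => (hψ i).deriv_packet_eq_zero _ h)
      fun h => (hψ j).deriv_packet_eq_zero _ h
  have hsplit : ∀ k s, ‖deriv (f k) s‖ ^ 2 + (ν k - Φ) ^ 2 * ‖f k s‖ ^ 2 - W s * ‖f k s‖ ^ 2 =
      ∑ i, (‖deriv (q k i) s‖ ^ 2 + (ν k - Φ) ^ 2 * ‖q k i s‖ ^ 2 - W s * ‖q k i s‖ ^ 2) := by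
    intro k s
    have h1 : ‖f k s‖ ^ 2 = ∑ i, ‖q k i s‖ ^ 2 := norm_sq_sum_of_disjoint _ (hdisj k s)
    have h2 : deriv (f k) s = ∑ i, deriv (q k i) s :=
      deriv_fun_sum fun i _ => (hqd k i).differentiable (by simp) s
    rw [h1, h2, norm_sq_sum_of_disjoint _ (hdisj' k s), Finset.sum_sub_distrib,
      Finset.sum_add_distrib, Finset.mul_sum, Finset.mul_sum]
  have hone : ∀ k, (∫ s, (‖deriv (f k) s‖ ^ 2 + (ν k - Φ) ^ 2 * ‖f k s‖ ^ 2)) -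
      ∫ s, W s * ‖f k s‖ ^ 2 ≤ ∑ i, Real.pi / (2 * ρ i) * ∑ j : Fin (J k i),
        ‖c ⟨k, i, j⟩‖ ^ 2 * (ρ i ^ 2 * ((j : ℕ) + 1) ^ 2 + (ν k - Φ) ^ 2 -
          ((A + (i : ℕ) * l + l) / K) ^ (-p⁻¹)) := by
    intro k
    rw [← integral_sub (hkin _ _ (hfc k) (hf'c k) (hfcs k)) (hpot _ (hfc k) (hf0 k))]
    simp only [hsplit]
    have hint : ∀ i ∈ Finset.univ, Integrable fun s => ‖deriv (q k i) s‖ ^ 2 +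
        (ν k - Φ) ^ 2 * ‖q k i s‖ ^ 2 - W s * ‖q k i s‖ ^ 2 := fun i _ =>
      (hkin _ _ (hqc k i) (hq'c k i) (hqcs k i)).sub (hpot _ (hqc k i) (hq0 k i))
    rw [integral_finsetSum _ hint]
    refine Finset.sum_le_sum fun i _ => ?_
    have hi : 0 ≤ ((i : ℕ) : ℝ) * l := by positivity
    refine (hψ i).integral_packet_le (by linarith) _
      ((continuousOn_powerProfile p hK).mono fun s hs => ?_) (fun s hs => ?_) (hJ k i)
    · exact lt_of_lt_of_le (by linarith) hs.1
    · have hs0 : 0 < s := by linarith [hs.1]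
      rw [powerProfile, if_pos hs0]
      refine Real.rpow_le_rpow_of_nonpos (by positivity) ?_ (by simp [hp.le])
      gcongr
      exact hs.2
  have hterm : ∀ k i (j : Fin (J k i)), ‖c ⟨k, i, j⟩‖ ^ 2 * (ρ i ^ 2 * ((j : ℕ) + 1) ^ 2 +
      (ν k - Φ) ^ 2 - ((A + (i : ℕ) * l + l) / K) ^ (-p⁻¹)) ≤ 0 := fun k i j =>
    mul_nonpos_of_nonneg_of_nonpos (sq_nonneg _) (by linarith [hJ k i j])
  have hρ : ∀ i, 0 < Real.pi / (2 * ρ i) := fun i => by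
    have := (hψ i).rho_pos
    positivity
  obtain ⟨⟨k, i, j⟩, hkij⟩ := Function.ne_iff.1 hc
  have hneg : ∑ k, ((∫ s, (‖deriv (f k) s‖ ^ 2 + (ν k - Φ) ^ 2 * ‖f k s‖ ^ 2)) -
      ∫ s, W s * ‖f k s‖ ^ 2) < 0 := by
    refine (Finset.sum_le_sum fun k _ => hone k).trans_lt ?_
    refine Finset.sum_neg' (fun k _ => Finset.sum_nonpos fun i _ =>
      mul_nonpos_of_nonneg_of_nonpos (hρ i).le (Finset.sum_nonpos fun j _ => hterm k i j))
      ⟨k, Finset.mem_univ _, ?_⟩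
    refine Finset.sum_neg' (fun i _ =>
      mul_nonpos_of_nonneg_of_nonpos (hρ i).le (Finset.sum_nonpos fun j _ => hterm k i j))
      ⟨i, Finset.mem_univ _, ?_⟩
    refine mul_neg_of_pos_of_neg (hρ i) (Finset.sum_neg' (fun j _ => hterm k i j)
      ⟨j, Finset.mem_univ _, ?_⟩)
    exact mul_neg_of_pos_of_neg (by have := norm_pos_iff.2 hkij; positivity)
      (by linarith [hJ k i j])
  rw [Finset.sum_sub_distrib] at hneg
  have hE' : magEnergy Φ (trialMap J ψ ν c) = _ := hE
  have hV' : ∫ x : ℝ × ℝ, powerPotential p K x * ‖trialMap J ψ ν c x‖ ^ 2 = _ := hV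
  rw [hE', hV']
  have := Real.pi_pos
  nlinarith

end Trial

section Counting

variable {Φ α C' : ℝ}

theorem sum_trial_card_le (hα : 0 < α) (hC' : 0 ≤ C')
    (hbound : ∀ V : ℝ × ℝ → ℝ, Measurable V → weakNorm α V < ⊤ →
      ∀ M : Submodule ℂ (ℝ × ℝ → ℂ), FiniteDimensional ℂ M → IsVNegative Φ V M →
        (Module.finrank ℂ M : ℝ) ≤ C' * (weakNorm α V).toReal)
    {κ : Type*} [Fintype κ] {ν : κ → ℤ} (hν : Function.Injective ν) {A l K : ℝ} (hA : 0 < A)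
    (hl : 1 < l) (hK : 0 < K) {P : ℕ} (J : κ → Fin P → ℕ)
    (hJ : ∀ k (i : Fin P) (j : Fin (J k i)),
      (Real.pi / (l - 1)) ^ 2 * ((j : ℕ) + 1) ^ 2 + (ν k - Φ) ^ 2 <
        ((A + (i : ℕ) * l + l) / K) ^ (-(1 + α / 2)⁻¹)) :
    ∑ k, ∑ i, (J k i : ℝ) ≤ C' * (2 * Real.pi * K) := by
  have hp : 0 < 1 + α / 2 := by positivity
  choose ψ ρ hρ hψ using fun i : Fin P => exists_isPhase (A + (i : ℕ) * l) hl
  have hJ' : ∀ k (i : Fin P) (j : Fin (J k i)),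
      ρ i ^ 2 * ((j : ℕ) + 1) ^ 2 + (ν k - Φ) ^ 2 <
        ((A + (i : ℕ) * l + l) / K) ^ (-(1 + α / 2)⁻¹) := by
    intro k i j
    have h0 := (hψ i).rho_pos
    have h1 := hρ i
    refine lt_of_le_of_lt ?_ (hJ k i j)
    gcongr
  have hlt : ∀ c : (Σ k, Σ i, Fin (J k i)) → ℂ, c ≠ 0 → _ := fun c hc =>
    magEnergy_trialMap_lt (ν := ν) Φ hν hp hK (by linarith) hA hψ hJ' hc
  have hinj : Function.Injective (trialMap J ψ ν) := by
    rw [← LinearMap.ker_eq_bot, LinearMap.ker_eq_bot']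
    intro c hc
    by_contra hne
    have h1 := hlt c hne
    rw [hc] at h1
    have h2 : 0 ≤ magEnergy Φ 0 := integral_nonneg fun x => by positivity
    simp only [Pi.zero_apply, norm_zero, ne_eq, OfNat.ofNat_ne_zero, not_false_eq_true, zero_pow,
      mul_zero, integral_zero] at h1
    linarith
  have hneg : IsVNegative Φ (powerPotential (1 + α / 2) K) (LinearMap.range (trialMap J ψ ν)) := by
    constructor
    · rintro _ ⟨c, rfl⟩
      exact isTestFun_trialMap (by linarith) hA hψ c
    · rintro _ ⟨c, rfl⟩ hc
      exact hlt c fun h => hc (by rw [h, map_zero])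
  have hw := weakNorm_powerPotential_le hα hK
  have h1 := hbound _ (measurable_powerPotential _ K) (hw.trans_lt ENNReal.ofReal_lt_top) _
    inferInstance hneg
  rw [LinearMap.finrank_range_of_inj hinj, Module.finrank_fintype_fun_eq_card,
    Fintype.card_sigma] at h1
  simp only [Fintype.card_sigma, Fintype.card_fin] at h1
  push_cast at h1
  refine h1.trans (mul_le_mul_of_nonneg_left ?_ hC')
  exact ENNReal.toReal_le_of_le_ofReal (by positivity) hw

/-- The local density of trial functions at height `s` in the angular mode with effective
angular momentum `μ`. -/
noncomputable def modeDensity (q μ s : ℝ) : ℝ := Real.sqrt (s ^ (-q) - μ ^ 2)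

theorem sum_modeDensity_le (hα : 0 < α) (hC' : 0 ≤ C')
    (hbound : ∀ V : ℝ × ℝ → ℝ, Measurable V → weakNorm α V < ⊤ →
      ∀ M : Submodule ℂ (ℝ × ℝ → ℂ), FiniteDimensional ℂ M → IsVNegative Φ V M →
        (Module.finrank ℂ M : ℝ) ≤ C' * (weakNorm α V).toReal)
    {κ : Type*} [Fintype κ] {ν : κ → ℤ} (hν : Function.Injective ν) {a h : ℝ} (ha : 0 < a)
    (hh : 0 < h) (P : ℕ) :
    ∑ k, ∑ i : Fin P, h * modeDensity (1 + α / 2)⁻¹ (ν k - Φ) (a + (i : ℕ) * h + h) ≤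
      2 * Real.pi ^ 2 * C' := by
  set G : κ → Fin P → ℝ := fun k i =>
    modeDensity (1 + α / 2)⁻¹ (ν k - Φ) (a + (i : ℕ) * h + h) with hG
  have hG0 : ∀ k i, 0 ≤ G k i := fun k i => Real.sqrt_nonneg _
  have hK : ∀ K : ℝ, 1 / h < K →
      ∑ k, ∑ i, ((h - K⁻¹) / Real.pi * G k i - K⁻¹) ≤ C' * (2 * Real.pi) := by
    intro K hKh
    have hK0 : 0 < K := lt_trans (by positivity) hKh
    have hl : 1 < K * h := by rwa [div_lt_iff₀ hh] at hKh
    have hl1 : 0 < K * h - 1 := by linarith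
    have hcount := sum_trial_card_le hα hC' hbound hν (A := K * a) (l := K * h) (by positivity) hl
      hK0 (fun k (i : Fin P) => ⌈(K * h - 1) / Real.pi * G k i⌉₊ - 1) (by
        intro k i j
        have h1 : ((j : ℕ) : ℝ) + 1 < (K * h - 1) / Real.pi * G k i := by
          have h2 : (j : ℕ) + 1 < ⌈(K * h - 1) / Real.pi * G k i⌉₊ := by have := j.2; omega
          exact_mod_cast Nat.lt_ceil.1 h2
        have h3 : Real.pi / (K * h - 1) * ((j : ℕ) + 1) < G k i := by
          have h4 := mul_lt_mul_of_pos_left h1 (div_pos Real.pi_pos hl1)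
          have h5 : Real.pi / (K * h - 1) * ((K * h - 1) / Real.pi * G k i) = G k i := by
            have := Real.pi_pos.ne'
            field_simp
          rwa [h5] at h4
        have h6 := (Real.lt_sqrt (by positivity)).1 h3
        rw [mul_pow] at h6
        have h7 : (K * a + (i : ℕ) * (K * h) + K * h) / K = a + (i : ℕ) * h + h := by
          field_simp
        rw [h7]
        linarith)
    have h8 : K * ∑ k, ∑ i, ((h - K⁻¹) / Real.pi * G k i - K⁻¹) ≤ C' * (2 * Real.pi * K) := by
      refine le_trans ?_ hcount
      rw [Finset.mul_sum]
      refine Finset.sum_le_sum fun k _ => ?_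
      rw [Finset.mul_sum]
      refine Finset.sum_le_sum fun i _ => ?_
      have h9 : K * ((h - K⁻¹) / Real.pi * G k i - K⁻¹) = (K * h - 1) / Real.pi * G k i - 1 := by
        field_simp
      have h10 := Nat.le_ceil ((K * h - 1) / Real.pi * G k i)
      have h11 : ⌈(K * h - 1) / Real.pi * G k i⌉₊ ≤ ⌈(K * h - 1) / Real.pi * G k i⌉₊ - 1 + 1 := by
        omega
      have h12 : (⌈(K * h - 1) / Real.pi * G k i⌉₊ : ℝ) ≤
          ((⌈(K * h - 1) / Real.pi * G k i⌉₊ - 1 : ℕ) : ℝ) + 1 := by exact_mod_cast h11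
      rw [h9]
      linarith
    refine le_of_mul_le_mul_left (h8.trans_eq (by ring)) hK0
  have hlim : Filter.Tendsto (fun K : ℝ => ∑ k, ∑ i, ((h - K⁻¹) / Real.pi * G k i - K⁻¹))
      Filter.atTop (nhds (∑ k, ∑ i, ((h - 0) / Real.pi * G k i - 0))) := by
    refine tendsto_finsetSum _ fun k _ => tendsto_finsetSum _ fun i _ => ?_
    have := tendsto_inv_atTop_zero (𝕜 := ℝ)
    exact (((tendsto_const_nhds.sub this).div_const _).mul_const _).sub this
  have hle := le_of_tendsto hlim ((Filter.eventually_gt_atTop (1 / h)).mono hK)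
  have hpi := Real.pi_pos
  calc ∑ k, ∑ i, h * G k i = Real.pi * ∑ k, ∑ i, ((h - 0) / Real.pi * G k i - 0) := by
        simp only [Finset.mul_sum]
        refine Finset.sum_congr rfl fun k _ => Finset.sum_congr rfl fun i _ => ?_
        field_simp
        ring
    _ ≤ Real.pi * (C' * (2 * Real.pi)) := by gcongr
    _ = _ := by ring

end Counting

theorem integral_le_of_forall_riemann_sum_le {g : ℝ → ℝ} {B : ℝ} (hg : AntitoneOn g (Set.Ioi 0))
    (hg0 : ∀ s, 0 ≤ g s) (hgi : IntegrableOn g (Set.Ioi 0))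
    (hB : ∀ a h : ℝ, 0 < a → 0 < h → ∀ P : ℕ,
      ∑ i ∈ Finset.range P, h * g (a + i * h + h) ≤ B) :
    ∫ s in Set.Ioi 0, g s ≤ B := by
  have hcompact : ∀ a b : ℝ, 0 < a → a < b → ∫ s in a..b, g s ≤ B := by
    intro a b ha hab
    have hP : ∀ P : ℕ, 0 < P → ∫ s in a..b, g s ≤ B + (b - a) * (P : ℝ)⁻¹ * g a := by
      intro P hP
      have hP' : (0 : ℝ) < P := by exact_mod_cast hP
      have hh : 0 < (b - a) * (P : ℝ)⁻¹ := mul_pos (by linarith) (by positivity)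
      set h := (b - a) * (P : ℝ)⁻¹ with hh_def
      have hanti : AntitoneOn (fun x => g (a + h * x)) (Set.Icc (0 : ℝ) (0 + P)) := by
        intro x hx y hy hxy
        have hx' : 0 ≤ h * x := mul_nonneg hh.le hx.1
        have hy' : 0 ≤ h * y := mul_nonneg hh.le hy.1
        exact hg (Set.mem_Ioi.2 (by linarith)) (Set.mem_Ioi.2 (by linarith)) (by gcongr)
      have h1 := hanti.integral_le_sum
      have h2 := intervalIntegral.smul_integral_comp_add_mul (a := (0 : ℝ)) (b := 0 + (P : ℝ)) g h a
      have h3 : a + h * (0 + P) = b := by rw [hh_def]; field_simp; ring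
      rw [h3, mul_zero, add_zero, smul_eq_mul] at h2
      rw [← h2]
      have h4 : ∑ i ∈ Finset.range P, g (a + h * (0 + i)) ≤
          ∑ i ∈ Finset.range P, g (a + i * h + h) + g a := by
        calc ∑ i ∈ Finset.range P, g (a + h * (0 + i))
            ≤ ∑ i ∈ Finset.range (P + 1), g (a + h * (0 + i)) :=
              Finset.sum_le_sum_of_subset_of_nonneg (Finset.range_subset_range.2 (by omega))
                fun i _ _ => hg0 _
          _ = _ := by
              rw [Finset.sum_range_succ']
              congr 1
              · refine Finset.sum_congr rfl fun i _ => ?_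
                congr 1
                push_cast
                ring
              · simp
      have h5 := hB a h ha hh P
      rw [← Finset.mul_sum] at h5
      calc _ ≤ h * (∑ i ∈ Finset.range P, g (a + i * h + h) + g a) := by
            gcongr
            exact h1.trans h4
        _ ≤ B + h * g a := by linarith
    have hlim : Filter.Tendsto (fun P : ℕ => B + (b - a) * (P : ℝ)⁻¹ * g a) Filter.atTop
        (nhds (B + (b - a) * 0 * g a)) :=
      tendsto_const_nhds.add ((tendsto_inv_atTop_nhds_zero_nat.const_mul _).mul_const _)
    have := ge_of_tendsto hlim ((Filter.eventually_gt_atTop 0).mono hP)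
    simpa using this
  have hmono : Monotone fun n : ℕ => Set.Ioc ((n : ℝ) + 2)⁻¹ ((n : ℝ) + 2) := by
    intro m n hmn
    have : (m : ℝ) ≤ n := by exact_mod_cast hmn
    exact Set.Ioc_subset_Ioc (by gcongr) (by linarith)
  have hunion : ⋃ n : ℕ, Set.Ioc ((n : ℝ) + 2)⁻¹ ((n : ℝ) + 2) = Set.Ioi 0 := by
    ext s
    simp only [Set.mem_iUnion, Set.mem_Ioc, Set.mem_Ioi]
    constructor
    · rintro ⟨n, h1, -⟩
      exact lt_trans (by positivity) h1
    · intro hs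
      obtain ⟨n, hn⟩ := exists_nat_ge (max s s⁻¹)
      have h1 := (le_max_left _ _).trans hn
      have h2 := (le_max_right _ _).trans hn
      exact ⟨n, inv_lt_of_inv_lt₀ hs (by linarith), by linarith⟩
  have hlim := tendsto_setIntegral_of_monotone (f := g) (μ := volume)
    (fun n : ℕ => measurableSet_Ioc) hmono (by rwa [hunion])
  rw [hunion] at hlim
  refine le_of_tendsto' hlim fun n => ?_
  have h2 : ((n : ℝ) + 2)⁻¹ < (n : ℝ) + 2 := by
    have h0 : (0 : ℝ) ≤ n := n.cast_nonneg
    have := inv_le_one_of_one_le₀ (a := (n : ℝ) + 2) (by linarith)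
    linarith
  rw [← intervalIntegral.integral_of_le h2.le]
  exact hcompact _ _ (by positivity) h2

theorem ofReal_beta_integrand (u v : ℝ) {x : ℝ} (hx : x ∈ Set.Ioo (0 : ℝ) 1) :
    (x : ℂ) ^ ((u : ℂ) - 1) * (1 - (x : ℂ)) ^ ((v : ℂ) - 1) =
      ((x ^ (u - 1) * (1 - x) ^ (v - 1) : ℝ) : ℂ) := by
  rw [Complex.ofReal_mul, Complex.ofReal_cpow hx.1.le, Complex.ofReal_cpow (by linarith [hx.2])]
  push_cast
  rfl

theorem integrableOn_beta_integrand {u v : ℝ} (hu : 0 < u) (hv : 0 < v) :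
    IntegrableOn (fun x : ℝ => x ^ (u - 1) * (1 - x) ^ (v - 1)) (Set.Ioo 0 1) := by
  have h := Complex.betaIntegral_convergent (u := u) (v := v) (by simpa) (by simpa)
  rw [intervalIntegrable_iff_integrableOn_Ioo_of_le zero_le_one] at h
  have h' := (h.congr_fun (fun x hx => ofReal_beta_integrand u v hx) measurableSet_Ioo).re
  simpa [IntegrableOn] using h'

theorem setIntegral_beta_integrand {u v : ℝ} (hu : 0 < u) (hv : 0 < v) :
    ∫ x : ℝ in Set.Ioo 0 1, x ^ (u - 1) * (1 - x) ^ (v - 1) =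
      Real.Gamma u * Real.Gamma v / Real.Gamma (u + v) := by
  change _ = ProbabilityTheory.beta u v
  rw [ProbabilityTheory.beta_eq_betaIntegralReal u v hu hv, Complex.betaIntegral,
    intervalIntegral.integral_of_le zero_le_one, integral_Ioc_eq_integral_Ioo,
    setIntegral_congr_fun measurableSet_Ioo (fun x hx => ofReal_beta_integrand u v hx),
    integral_complex_ofReal, Complex.ofReal_re]

/-- The scale-invariant form of `modeDensity` in the variable `μ² s ^ q`. -/
noncomputable def unitDensity (p z : ℝ) : ℝ := z ^ (p - 1) * Real.sqrt (z⁻¹ - 1)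

theorem unitDensity_eq_zero (p : ℝ) {z : ℝ} (hz : 1 ≤ z) : unitDensity p z = 0 := by
  rw [unitDensity, Real.sqrt_eq_zero_of_nonpos, mul_zero]
  linarith [inv_le_one_of_one_le₀ hz]

theorem unitDensity_eq (p : ℝ) {z : ℝ} (hz : z ∈ Set.Ioo (0 : ℝ) 1) :
    unitDensity p z = z ^ ((p - 1 / 2) - 1) * (1 - z) ^ ((3 / 2 : ℝ) - 1) := by
  have h1 : z⁻¹ - 1 = z⁻¹ * (1 - z) := by
    have := hz.1.ne'
    field_simp
  rw [unitDensity, h1, Real.sqrt_eq_rpow,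
    Real.mul_rpow (inv_nonneg.2 hz.1.le) (by linarith [hz.2]), ← mul_assoc,
    Real.inv_rpow hz.1.le, ← Real.rpow_neg hz.1.le, ← Real.rpow_add hz.1]
  norm_num
  left
  congr 1
  ring

theorem integrableOn_unitDensity {p : ℝ} (hp : 1 / 2 < p) :
    IntegrableOn (unitDensity p) (Set.Ioi 0) := by
  have h := integrableOn_beta_integrand (u := p - 1 / 2) (v := 3 / 2) (by linarith) (by norm_num)
  have h' := h.congr_fun (fun z hz => (unitDensity_eq p hz).symm) measurableSet_Ioo
  refine h'.of_forall_sdiff_eq_zero measurableSet_Ioi fun z hz => unitDensity_eq_zero p ?_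
  by_contra! hz1
  exact hz.2 ⟨hz.1, hz1⟩

theorem setIntegral_unitDensity {p : ℝ} (hp : 1 / 2 < p) :
    ∫ z in Set.Ioi 0, unitDensity p z =
      Real.Gamma (p - 1 / 2) * Real.Gamma (3 / 2) / Real.Gamma (p + 1) := by
  rw [setIntegral_eq_of_subset_of_forall_sdiff_eq_zero measurableSet_Ioi
    (fun z hz => hz.1 : Set.Ioo (0 : ℝ) 1 ⊆ Set.Ioi 0) fun z hz => unitDensity_eq_zero p ?_,
    setIntegral_congr_fun measurableSet_Ioo fun z hz => unitDensity_eq p hz,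
    setIntegral_beta_integrand (by linarith) (by norm_num)]
  · congr 2
    ring
  · by_contra! hz1
    exact hz.2 ⟨hz.1, hz1⟩

theorem modeDensity_comp_rpow {p μ : ℝ} (hp : 0 < p) (hμ : μ ≠ 0) {y : ℝ} (hy : 0 < y) :
    (p * y ^ (p - 1)) • modeDensity p⁻¹ μ (y ^ p) =
      p * |μ| ^ (3 - 2 * p) * unitDensity p (μ ^ 2 * y) := by
  have hm : 0 < |μ| := abs_pos.2 hμ
  have h1 : (y ^ p) ^ (-p⁻¹) = y⁻¹ := by
    rw [← Real.rpow_mul hy.le, mul_neg, mul_inv_cancel₀ hp.ne', Real.rpow_neg_one]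
  have h2 : y⁻¹ - μ ^ 2 = μ ^ 2 * ((μ ^ 2 * y)⁻¹ - 1) := by field_simp
  have h3 : (μ ^ 2 * y) ^ (p - 1) = |μ| ^ (2 * p - 2) * y ^ (p - 1) := by
    rw [Real.mul_rpow (sq_nonneg _) hy.le, ← sq_abs, ← Real.rpow_natCast, ← Real.rpow_mul hm.le]
    congr 2
    push_cast
    ring
  have h4 : |μ| ^ (3 - 2 * p) * |μ| ^ (2 * p - 2) = |μ| := by
    rw [← Real.rpow_add hm]
    ring_nf
    exact Real.rpow_one _
  rw [modeDensity, unitDensity, h1, h2, h3, Real.sqrt_mul (sq_nonneg _), Real.sqrt_sq_eq_abs,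
    smul_eq_mul]
  linear_combination -p * y ^ (p - 1) * Real.sqrt ((μ ^ 2 * y)⁻¹ - 1) * h4

theorem integrableOn_modeDensity {p μ : ℝ} (hp : 1 / 2 < p) (hμ : μ ≠ 0) :
    IntegrableOn (modeDensity p⁻¹ μ) (Set.Ioi 0) := by
  have hp0 : 0 < p := by linarith
  rw [← integrableOn_Ioi_comp_rpow_iff _ hp0.ne', abs_of_pos hp0]
  refine IntegrableOn.congr_fun ?_ (fun y hy => (modeDensity_comp_rpow hp0 hμ hy).symm)
    measurableSet_Ioi
  refine Integrable.const_mul ?_ _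
  have := (integrableOn_Ioi_comp_mul_left_iff (unitDensity p) 0 (a := μ ^ 2) (by positivity)).2
    (by rw [mul_zero]; exact integrableOn_unitDensity hp)
  exact this

theorem setIntegral_modeDensity {p μ : ℝ} (hp : 1 / 2 < p) (hμ : μ ≠ 0) :
    ∫ s in Set.Ioi 0, modeDensity p⁻¹ μ s =
      Real.Gamma (p - 1 / 2) * (Real.sqrt Real.pi / 2) / Real.Gamma p * |μ| ^ (1 - 2 * p) := by
  have hp0 : 0 < p := by linarith
  have hm : 0 < |μ| := abs_pos.2 hμ
  have hG : 0 < Real.Gamma p := Real.Gamma_pos_of_pos hp0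
  have h32 : Real.Gamma (3 / 2) = Real.sqrt Real.pi / 2 := by
    rw [show (3 / 2 : ℝ) = 1 / 2 + 1 by norm_num, Real.Gamma_add_one (by norm_num),
      Real.Gamma_one_half_eq]
    ring
  have hpow : |μ| ^ (3 - 2 * p) = |μ| ^ (1 - 2 * p) * μ ^ 2 := by
    rw [← sq_abs, ← Real.rpow_natCast, ← Real.rpow_add hm]
    congr 1
    push_cast
    ring
  rw [← integral_comp_rpow_Ioi_of_pos hp0,
    setIntegral_congr_fun measurableSet_Ioi fun y hy => modeDensity_comp_rpow hp0 hμ hy,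
    integral_const_mul, integral_comp_mul_left_Ioi _ _ (by positivity : 0 < μ ^ 2), mul_zero,
    setIntegral_unitDensity hp, Real.Gamma_add_one hp0.ne', h32, hpow, smul_eq_mul]
  field_simp

theorem antitoneOn_modeDensity {q : ℝ} (hq : 0 ≤ q) (μ : ℝ) :
    AntitoneOn (modeDensity q μ) (Set.Ioi 0) := by
  intro x hx y hy hxy
  refine Real.sqrt_le_sqrt (sub_le_sub_right ?_ _)
  exact Real.rpow_le_rpow_of_nonpos hx hxy (by linarith)

theorem integral_sum_modeDensity_le {Φ α C' : ℝ} (hΦ : ∀ k : ℤ, Φ ≠ k) (hα : 0 < α)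
    (hC' : 0 ≤ C')
    (hbound : ∀ V : ℝ × ℝ → ℝ, Measurable V → weakNorm α V < ⊤ →
      ∀ M : Submodule ℂ (ℝ × ℝ → ℂ), FiniteDimensional ℂ M → IsVNegative Φ V M →
        (Module.finrank ℂ M : ℝ) ≤ C' * (weakNorm α V).toReal)
    (F : Finset ℤ) :
    ∑ n ∈ F, ∫ s in Set.Ioi 0, modeDensity (1 + α / 2)⁻¹ (n - Φ) s ≤ 2 * Real.pi ^ 2 * C' := by
  have hint : ∀ n ∈ F, IntegrableOn (modeDensity (1 + α / 2)⁻¹ (n - Φ)) (Set.Ioi 0) :=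
    fun n _ => integrableOn_modeDensity (by linarith) (sub_ne_zero.2 (hΦ n).symm)
  rw [← integral_finsetSum _ hint]
  refine integral_le_of_forall_riemann_sum_le (fun x hx y hy hxy => ?_)
    (fun s => Finset.sum_nonneg fun n _ => Real.sqrt_nonneg _) (integrable_finsetSum _ hint)
    fun a h ha hh P => ?_
  · exact Finset.sum_le_sum fun n _ => antitoneOn_modeDensity (by positivity) _ hx hy hxy
  · refine le_trans (le_of_eq ?_) (sum_modeDensity_le hα hC' hbound
      (Subtype.val_injective (p := (· ∈ F))) ha hh P)
    simp only [Finset.mul_sum]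
    rw [Finset.sum_comm, ← Finset.sum_coe_sort F]
    exact Finset.sum_congr rfl fun n _ => (Fin.sum_univ_eq_sum_range
      (fun i => h * modeDensity (1 + α / 2)⁻¹ (n - Φ) (a + i * h + h)) P).symm

theorem weak_weighted_CLR_constant_explicit_lower_bound
    (Φ : ℝ) (hΦ : ∀ k : ℤ, Φ ≠ k) (α : ℝ) (hα : 0 < α)
    (C' : ℝ) (hC' : 0 ≤ C')
    (hbound : ∀ V : ℝ × ℝ → ℝ, Measurable V → weakNorm α V < ⊤ →
      ∀ M : Submodule ℂ (ℝ × ℝ → ℂ), FiniteDimensional ℂ M → IsVNegative Φ V M →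
        (Module.finrank ℂ M : ℝ) ≤ C' * (weakNorm α V).toReal) :
    Real.Gamma ((1 + α) / 2) / (4 * Real.pi ^ ((3 : ℝ) / 2) * Real.Gamma (1 + α / 2)) *
      (∑' n : ℤ, |(n : ℝ) - Φ| ^ (-(1 + α))) ≤ C' := by
  rw [← tsum_mul_left]
  have hG1 : 0 < Real.Gamma ((1 + α) / 2) := Real.Gamma_pos_of_pos (by positivity)
  have hG2 : 0 < Real.Gamma (1 + α / 2) := Real.Gamma_pos_of_pos (by positivity)
  have hpi := Real.pi_pos
  have hsqrt : 0 < Real.sqrt Real.pi := Real.sqrt_pos.2 hpi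
  refine Real.tsum_le_of_sum_le (fun n => by positivity) fun F => ?_
  have h := integral_sum_modeDensity_le hΦ hα hC' hbound F
  have hpow : Real.pi ^ ((3 : ℝ) / 2) = Real.pi * Real.sqrt Real.pi := by
    rw [Real.sqrt_eq_rpow, ← Real.rpow_one_add' hpi.le (by norm_num)]
    norm_num
  have hsum : ∑ n ∈ F, ∫ s in Set.Ioi 0, modeDensity (1 + α / 2)⁻¹ (n - Φ) s =
      2 * Real.pi ^ 2 * ∑ n ∈ F, Real.Gamma ((1 + α) / 2) /
        (4 * Real.pi ^ ((3 : ℝ) / 2) * Real.Gamma (1 + α / 2)) *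
          |(n : ℝ) - Φ| ^ (-(1 + α)) := by
    rw [Finset.mul_sum]
    refine Finset.sum_congr rfl fun n _ => ?_
    rw [setIntegral_modeDensity (by linarith) (sub_ne_zero.2 (hΦ n).symm), hpow,
      show 1 + α / 2 - 1 / 2 = (1 + α) / 2 by ring,
      show 1 - 2 * (1 + α / 2) = -(1 + α) by ring]
    have hs := Real.mul_self_sqrt hpi.le
    field_simp
    linear_combination 4 * |(n : ℝ) - Φ| ^ (-(1 + α)) * hs
  rw [hsum] at h
  exact le_of_mul_le_mul_left h (by positivity)
end

section
/- For every antisymmetric u ∈ C_c^∞(ℝ²\{0}; ℂ), i.e. u(x₁,x₂) = −u(x₂,x₁) for all x: ∫_{ℝ²} |∇u(x)|² dx ≥ ∫_{ℝ²} |u(x)|² / |x|² dx. (Hardy inequality with constant 1 for antisymmetric functions in two dimensions.) -/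
open MeasureTheory

/-- A function on `ℝ²` is antisymmetric if `u(x₁,x₂) = -u(x₂,x₁)`. -/
def Antisym (u : ℝ × ℝ → ℂ) : Prop := ∀ x : ℝ × ℝ, u (x.2, x.1) = -u x

/-- The Dirichlet energy `∫ |∇u|²` on `ℝ²`. -/
noncomputable def gradEnergy (u : ℝ × ℝ → ℂ) : ℝ :=
  ∫ x : ℝ × ℝ, (‖fderiv ℝ u x (1, 0)‖ ^ 2 + ‖fderiv ℝ u x (0, 1)‖ ^ 2)

/-- A subspace `M` of antisymmetric test functions on which the quadratic form
`u ↦ ∫ |∇u|² - ∫ V |u|²` is negative for all nonzero `u`. -/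
def IsVNegativeAnti (V : ℝ × ℝ → ℝ) (M : Submodule ℂ (ℝ × ℝ → ℂ)) : Prop :=
  (∀ u ∈ M, IsTestFun u ∧ Antisym u) ∧
  ∀ u ∈ M, u ≠ 0 → gradEnergy u < ∫ x : ℝ × ℝ, V x * ‖u x‖ ^ 2

open Real Set Filter Topology in
/-- One-dimensional Poincaré inequality on an interval of length `π` with Dirichlet boundary
conditions. -/
theorem integral_norm_sq_le_integral_norm_deriv_sq {E : Type*} [NormedAddCommGroup E]
    [InnerProductSpace ℝ E] {f f' : ℝ → E} {c : ℝ}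
    (hf : ∀ x, HasDerivAt f (f' x) x) (hf' : Continuous f')
    (hl : f (c - π / 2) = 0) (hr : f (c + π / 2) = 0) :
    ∫ x in (c - π / 2)..(c + π / 2), ‖f x‖ ^ 2 ≤ ∫ x in (c - π / 2)..(c + π / 2), ‖f' x‖ ^ 2 := by
  have hfc : Continuous f := continuous_iff_continuousAt.2 fun x => (hf x).continuousAt
  have hab : c - π / 2 ≤ c + π / 2 := by linarith [pi_pos]
  set A := ∫ x in (c - π / 2)..(c + π / 2), ‖f x‖ ^ 2
  have key : ∀ ω : ℝ, 0 < ω → ω < 1 →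
      ω ^ 2 * A ≤ ∫ x in (c - π / 2)..(c + π / 2), ‖f' x‖ ^ 2 := by
    intro ω h0 h1
    have hcos : ∀ x ∈ Icc (c - π / 2) (c + π / 2), cos (ω * (x - c)) ≠ 0 := by
      intro x hx
      refine (cos_pos_of_mem_Ioo ⟨?_, ?_⟩).ne'
      · nlinarith [hx.1, pi_pos]
      · nlinarith [hx.2, pi_pos]
    let G' : ℝ → ℝ := fun x => (ω * (1 / cos (ω * (x - c)) ^ 2 * (ω * 1))) * ‖f x‖ ^ 2 +
      ω * tan (ω * (x - c)) * (2 * inner ℝ (f x) (f' x))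
    have hG : ∀ x ∈ uIcc (c - π / 2) (c + π / 2),
        HasDerivAt (fun x => ω * tan (ω * (x - c)) * ‖f x‖ ^ 2) (G' x) x := by
      intro x hx
      rw [uIcc_of_le hab] at hx
      have h2 : HasDerivAt (fun x => ω * (x - c)) (ω * 1) x :=
        ((hasDerivAt_id x).sub_const c).const_mul ω
      have h3 := (hasDerivAt_tan (hcos x hx)).comp x h2
      exact (h3.const_mul ω).mul (hf x).norm_sq
    have hGc : ContinuousOn G' (uIcc (c - π / 2) (c + π / 2)) := by
      rw [uIcc_of_le hab]
      have h2 : ContinuousOn (fun x => tan (ω * (x - c))) (Icc (c - π / 2) (c + π / 2)) := by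
        simp only [tan_eq_sin_div_cos]
        exact ContinuousOn.div (by fun_prop) (by fun_prop) hcos
      have h3 : ContinuousOn (fun x => 1 / cos (ω * (x - c)) ^ 2)
          (Icc (c - π / 2) (c + π / 2)) :=
        ContinuousOn.div (by fun_prop) (by fun_prop) fun x hx => pow_ne_zero 2 (hcos x hx)
      have h4 : Continuous fun x => inner ℝ (f x) (f' x) := hfc.inner hf'
      exact ((continuousOn_const.mul (h3.mul continuousOn_const)).mul (by fun_prop)).add
        ((continuousOn_const.mul h2).mul (by fun_prop))
    have hint := intervalIntegral.integral_eq_sub_of_hasDerivAt hG hGc.intervalIntegrable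
    rw [hl, hr] at hint
    simp only [norm_zero, ne_eq, OfNat.ofNat_ne_zero, not_false_eq_true, zero_pow, mul_zero,
      sub_zero] at hint
    have hi : IntervalIntegrable (fun x => ‖f' x‖ ^ 2) volume (c - π / 2) (c + π / 2) :=
      (by fun_prop : Continuous fun x => ‖f' x‖ ^ 2).intervalIntegrable _ _
    have hmono : ∫ x in (c - π / 2)..(c + π / 2), ω ^ 2 * ‖f x‖ ^ 2 ≤
        ∫ x in (c - π / 2)..(c + π / 2), (‖f' x‖ ^ 2 + G' x) := by
      refine intervalIntegral.integral_mono_on hab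
        ((by fun_prop : Continuous fun x => ω ^ 2 * ‖f x‖ ^ 2).intervalIntegrable _ _)
        (hi.add hGc.intervalIntegrable) fun x hx => ?_
      have hsq := norm_add_sq_real (f' x) ((ω * tan (ω * (x - c))) • f x)
      rw [inner_smul_right, norm_smul, mul_pow, norm_eq_abs, sq_abs, real_inner_comm] at hsq
      have htan : 1 / cos (ω * (x - c)) ^ 2 = 1 + tan (ω * (x - c)) ^ 2 := by
        rw [← inv_one_add_tan_sq (hcos x hx), one_div, inv_inv]
      have := sq_nonneg ‖f' x + (ω * tan (ω * (x - c))) • f x‖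
      simp only [G', htan]
      nlinarith
    rw [intervalIntegral.integral_add hi hGc.intervalIntegrable, hint, add_zero,
      intervalIntegral.integral_const_mul] at hmono
    exact hmono
  have ht : Tendsto (fun ω : ℝ => ω ^ 2 * A) (𝓝[<] 1) (𝓝 A) := by
    have : Tendsto (fun ω : ℝ => ω ^ 2 * A) (𝓝 1) (𝓝 ((1 : ℝ) ^ 2 * A)) :=
      (by fun_prop : Continuous fun ω : ℝ => ω ^ 2 * A).tendsto 1
    rw [one_pow, one_mul] at this
    exact this.mono_left nhdsWithin_le_nhds
  refine le_of_tendsto ht ?_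
  filter_upwards [Ioo_mem_nhdsLT (zero_lt_one' ℝ)] with ω hω using key ω hω.1 hω.2

open Real Set in
/-- The angular Hardy inequality for an antisymmetric function on the circle of radius `r`. -/
theorem integral_circle_norm_sq_le {u : ℝ × ℝ → ℂ} (hu : ContDiff ℝ 1 u) (ha : Antisym u)
    (r : ℝ) :
    ∫ θ in (-π)..π, ‖u (r * cos θ, r * sin θ)‖ ^ 2 ≤
      ∫ θ in (-π)..π, r ^ 2 * (‖fderiv ℝ u (r * cos θ, r * sin θ) (1, 0)‖ ^ 2 +
        ‖fderiv ℝ u (r * cos θ, r * sin θ) (0, 1)‖ ^ 2) := by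
  have hdiag : ∀ t : ℝ, u (t, t) = 0 := fun t => self_eq_neg.1 (ha (t, t))
  have hfd : Continuous (fderiv ℝ u) := hu.continuous_fderiv one_ne_zero
  have huc := hu.continuous
  let f : ℝ → ℂ := fun θ => u (r * cos θ, r * sin θ)
  let f' : ℝ → ℂ := fun θ =>
    fderiv ℝ u (r * cos θ, r * sin θ) (r * -sin θ, r * cos θ)
  have hf : ∀ θ, HasDerivAt f (f' θ) θ := fun θ =>
    ((hu.differentiable one_ne_zero _).hasFDerivAt).comp_hasDerivAt θ
      (((hasDerivAt_cos θ).const_mul r).prodMk ((hasDerivAt_sin θ).const_mul r))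
  have hf' : Continuous f' := by fun_prop
  have hfc : Continuous f := by fun_prop
  have hcos : cos (π / 4) = sin (π / 4) := by rw [cos_pi_div_four, sin_pi_div_four]
  have z1 : f (-π / 4 + π / 2) = 0 := by
    have : -π / 4 + π / 2 = π / 4 := by ring
    simp only [f, this, hcos, hdiag]
  have z2 : f (-π / 4 - π / 2) = 0 := by
    have : -π / 4 - π / 2 = π / 4 - π := by ring
    simp only [f, this, cos_sub_pi, sin_sub_pi, hcos, hdiag]
  have z3 : f (3 * π / 4 - π / 2) = 0 := by
    have : 3 * π / 4 - π / 2 = π / 4 := by ring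
    simp only [f, this, hcos, hdiag]
  have z4 : f (3 * π / 4 + π / 2) = 0 := by
    have : 3 * π / 4 + π / 2 = π / 4 + π := by ring
    simp only [f, this, cos_add_pi, sin_add_pi, hcos, hdiag]
  have split : ∀ g : ℝ → ℝ, Continuous g → Function.Periodic g (2 * π) →
      ∫ θ in (-π)..π, g θ = (∫ θ in (-π / 4 - π / 2)..(-π / 4 + π / 2), g θ) +
        ∫ θ in (3 * π / 4 - π / 2)..(3 * π / 4 + π / 2), g θ := by
    intro g hg hp
    have h := hp.intervalIntegral_add_eq (-π) (-π / 4 - π / 2)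
    rw [show -π + 2 * π = π by ring,
      show -π / 4 - π / 2 + 2 * π = 3 * π / 4 + π / 2 by ring] at h
    rw [h, show 3 * π / 4 - π / 2 = -π / 4 + π / 2 by ring,
      intervalIntegral.integral_add_adjacent_intervals (hg.intervalIntegrable _ _)
        (hg.intervalIntegrable _ _)]
  calc ∫ θ in (-π)..π, ‖f θ‖ ^ 2 ≤ ∫ θ in (-π)..π, ‖f' θ‖ ^ 2 := by
        rw [split _ (by fun_prop) (fun θ => by simp [f]),
          split _ (by fun_prop) (fun θ => by simp [f'])]
        exact add_le_add (integral_norm_sq_le_integral_norm_deriv_sq hf hf' z2 z1)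
          (integral_norm_sq_le_integral_norm_deriv_sq hf hf' z3 z4)
    _ ≤ _ := by
        refine intervalIntegral.integral_mono_on (by linarith [pi_pos])
          ((by fun_prop : Continuous fun θ => ‖f' θ‖ ^ 2).intervalIntegrable _ _)
          (Continuous.intervalIntegrable (by fun_prop) _ _) fun θ _ => ?_
        set L := fderiv ℝ u (r * cos θ, r * sin θ)
        have hL : f' θ = (r * -sin θ) • L (1, 0) + (r * cos θ) • L (0, 1) := by
          rw [← map_smul, ← map_smul, ← map_add]
          simp [f', L]
        have h1 : ‖f' θ‖ ≤ |r| * (|sin θ| * ‖L (1, 0)‖ + |cos θ| * ‖L (0, 1)‖) := by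
          rw [hL]
          refine (norm_add_le _ _).trans_eq ?_
          simp only [norm_smul, norm_eq_abs, abs_mul, abs_neg]
          ring
        refine (pow_le_pow_left₀ (norm_nonneg _) h1 2).trans ?_
        rw [mul_pow, sq_abs]
        refine mul_le_mul_of_nonneg_left ?_ (sq_nonneg r)
        have h2 : |sin θ| ^ 2 + |cos θ| ^ 2 = 1 := by
          rw [sq_abs, sq_abs, sin_sq_add_cos_sq]
        have h3 := sq_nonneg (|sin θ| * ‖L (0, 1)‖ - |cos θ| * ‖L (1, 0)‖)
        calc _ ≤ (|sin θ| ^ 2 + |cos θ| ^ 2) * (‖L (1, 0)‖ ^ 2 + ‖L (0, 1)‖ ^ 2) := by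
              linarith
          _ = _ := by rw [h2, one_mul]

open Real Set in
theorem Hardy_antisymmetric (u : ℝ × ℝ → ℂ) (hu : IsTestFun u) (ha : Antisym u) :
    ∫ x : ℝ × ℝ, ‖u x‖ ^ 2 / sqnorm x ≤ gradEnergy u := by
  obtain ⟨hs, hc, -⟩ := hu
  have hu1 : ContDiff ℝ 1 u := hs.of_le (by exact_mod_cast le_top)
  have huc := hu1.continuous
  have hfd : Continuous (fderiv ℝ u) := hu1.continuous_fderiv one_ne_zero
  unfold gradEnergy
  by_cases hi : Integrable fun x : ℝ × ℝ => ‖u x‖ ^ 2 / sqnorm x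
  swap
  · rw [integral_undef hi]
    exact integral_nonneg fun x => by positivity
  have hg : Integrable fun x : ℝ × ℝ =>
      ‖fderiv ℝ u x (1, 0)‖ ^ 2 + ‖fderiv ℝ u x (0, 1)‖ ^ 2 := by
    refine Continuous.integrable_of_hasCompactSupport (by fun_prop) ?_
    exact (hc.fderiv ℝ).comp_left
      (g := fun L : ℝ × ℝ →L[ℝ] ℂ => ‖L (1, 0)‖ ^ 2 + ‖L (0, 1)‖ ^ 2) (by simp)
  rw [← sub_nonneg, ← integral_sub hg hi, ← integral_comp_polarCoord_symm, polarCoord_target]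
  set F : ℝ × ℝ → ℝ := fun p => p.1 •
    (‖fderiv ℝ u (polarCoord.symm p) (1, 0)‖ ^ 2 + ‖fderiv ℝ u (polarCoord.symm p) (0, 1)‖ ^ 2 -
      ‖u (polarCoord.symm p)‖ ^ 2 / sqnorm (polarCoord.symm p)) with hF
  by_cases hFi : IntegrableOn F (Ioi 0 ×ˢ Ioo (-π) π)
  swap
  · exact (integral_undef hFi).ge
  rw [Measure.volume_eq_prod] at hFi ⊢
  rw [setIntegral_prod _ hFi]
  refine setIntegral_nonneg measurableSet_Ioi fun r (hr : 0 < r) => ?_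
  have hsq : ∀ θ, sqnorm (r * cos θ, r * sin θ) = r ^ 2 := fun θ => by
    have := sin_sq_add_cos_sq θ
    simp only [sqnorm]
    linear_combination r ^ 2 * this
  have hcirc := integral_circle_norm_sq_le hu1 ha r
  rw [← sub_nonneg, ← intervalIntegral.integral_sub (Continuous.intervalIntegrable (by fun_prop) _ _)
    (Continuous.intervalIntegrable (by fun_prop) _ _),
    intervalIntegral.integral_of_le (by linarith [pi_pos]), integral_Ioc_eq_integral_Ioo] at hcirc
  have hFr : ∀ θ, F (r, θ) = r⁻¹ * (r ^ 2 * (‖fderiv ℝ u (r * cos θ, r * sin θ) (1, 0)‖ ^ 2 +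
      ‖fderiv ℝ u (r * cos θ, r * sin θ) (0, 1)‖ ^ 2) - ‖u (r * cos θ, r * sin θ)‖ ^ 2) := by
    intro θ
    simp only [hF, polarCoord_symm_apply, hsq, smul_eq_mul]
    field_simp
  simp only [hFr, integral_const_mul]
  exact mul_nonneg (inv_nonneg.2 hr.le) hcirc
end
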